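/- Let p, q, m, ℓ be positive integers with q ≥ 2p. If there exists a 3-astray good edge labeling of K_{4q} of (m,ℓ)_p type, then there exists a 3-astray good edge labeling of K_{8q} of (m+2, ℓ+2q)_p type, and there also exists a 3-astray good edge labeling of K_{8q+4} of (m+2, ℓ+2q)_p type. -/

import Mathlib

open Finset

namespace Swap

noncomputable section
open scoped Classical

def eps (n : ℕ) : ℕ := n * (n - 1) / 2

def incEdges (n : ℕ) (v : Fin n) : Finset (Sym2 (Fin n)) :=
  Finset.univ.filter fun e => v ∈ e ∧ ¬ e.IsDiag

def IsEdgeLabeling (n : ℕ) (t : Sym2 (Fin n) → ℕ) : Prop :=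
  Set.BijOn t {e : Sym2 (Fin n) | ¬ e.IsDiag} (Set.Icc 1 (eps n))

def labelSum (n : ℕ) (t : Sym2 (Fin n) → ℕ) (v : Fin n) : ℤ :=
  ∑ e ∈ incEdges n v, (t e : ℤ)

def labelSet (n : ℕ) (t : Sym2 (Fin n) → ℕ) (v : Fin n) : Finset ℕ :=
  (incEdges n v).image t

def AlmostSupermagic (n α : ℕ) (t : Sym2 (Fin n) → ℕ) : Prop :=
  IsEdgeLabeling n t ∧ ∀ u v : Fin n, |labelSum n t u - labelSum n t v| ≤ (α : ℤ)

def IsPSwap (n p : ℕ) (t t' : Sym2 (Fin n) → ℕ) : Prop :=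
  IsEdgeLabeling n t' ∧ ∀ e : Sym2 (Fin n), ¬ e.IsDiag → |(t' e : ℤ) - (t e : ℤ)| ≤ (p : ℤ)

def robustness (n p : ℕ) (t : Sym2 (Fin n) → ℕ) : ℕ :=
  sSup {d : ℕ | ∃ t' : Sym2 (Fin n) → ℕ, IsPSwap n p t t' ∧
    ∃ u v : Fin n, u ≠ v ∧ (d : ℤ) = |labelSum n t' u - labelSum n t' v|}

def Uplus (n p : ℕ) (t : Sym2 (Fin n) → ℕ) (v : Fin n) : Finset (Sym2 (Fin n)) :=
  (incEdges n v).filter fun e => ∃ e' ∈ incEdges n v, t e' = t e + p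

def Uminus (n p : ℕ) (t : Sym2 (Fin n) → ℕ) (v : Fin n) : Finset (Sym2 (Fin n)) :=
  (incEdges n v).filter fun e => ∃ e' ∈ incEdges n v, t e' + p = t e

def badPairsI (n p : ℕ) (t : Sym2 (Fin n) → ℕ) (u v : Fin n) :
    Finset (Sym2 (Sym2 (Fin n))) :=
  Finset.univ.filter fun P => ∃ e₁ e₂ : Sym2 (Fin n), P = s(e₁, e₂) ∧
    ¬ e₁.IsDiag ∧ ¬ e₂.IsDiag ∧ u ∈ e₁ ∧ v ∈ e₂ ∧ ((t e₁ : ℤ) - (t e₂ : ℤ)).natAbs = p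

def badPairsII (n p : ℕ) (t : Sym2 (Fin n) → ℕ) (u v : Fin n) :
    Finset (Sym2 (Sym2 (Fin n))) :=
  Finset.univ.filter fun P => ∃ e₁ e₂ : Sym2 (Fin n), P = s(e₁, e₂) ∧
    ¬ e₁.IsDiag ∧ ¬ e₂.IsDiag ∧ u ∈ e₁ ∧ v ∈ e₂ ∧ ((t e₁ : ℤ) - (t e₂ : ℤ)).natAbs = 2 * p

def badPairs (n p : ℕ) (t : Sym2 (Fin n) → ℕ) (u v : Fin n) :
    Finset (Sym2 (Sym2 (Fin n))) :=
  badPairsI n p t u v ∪ badPairsII n p t u v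

def IsAP1 (I : Finset ℕ) : Prop := ∃ a b : ℕ, a ≤ b ∧ I = Finset.Icc a b

def SetHasType (p m ℓ : ℕ) (S : Finset ℕ) : Prop :=
  ∃ 𝒜 : Finset (Finset ℕ), 𝒜.card ≤ m ∧
    (∀ I ∈ 𝒜, IsAP1 I ∧ I ⊆ S ∧ 2 * p ≤ I.card) ∧
    (𝒜 : Set (Finset ℕ)).PairwiseDisjoint id ∧
    ℓ ≤ ∑ I ∈ 𝒜, I.card

def LabelingHasType (n p m ℓ : ℕ) (t : Sym2 (Fin n) → ℕ) : Prop :=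
  ∀ v : Fin n, SetHasType p m ℓ (labelSet n t v)

def AstrayGood (n b : ℕ) (t : Sym2 (Fin n) → ℕ) : Prop :=
  IsEdgeLabeling n t ∧
  ∃ A : Finset (Sym2 (Fin n)), (∀ e ∈ A, ¬ e.IsDiag) ∧
    A.card % 2 = eps n % 2 ∧
    A.image t = Finset.Icc ((eps n - A.card) / 2 + 1) ((eps n + A.card) / 2) ∧
    ∀ v : Fin n,
      (incEdges n v ∩ A).card ≤ b ∧
      ((incEdges n v).filter fun e => t e ≤ (eps n - A.card) / 2).card
        = ((incEdges n v).filter fun e => (eps n + A.card) / 2 < t e).card ∧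
      2 * ∑ e ∈ incEdges n v \ A, t e = (incEdges n v \ A).card * (eps n + 1)

def Admissible (p : ℕ → ℕ) : Prop :=
  Filter.Tendsto (fun n => (p n : ℝ) / n) Filter.atTop (nhds 0) ∧
  Filter.Tendsto p Filter.atTop Filter.atTop

end
end Swap


namespace Swap17

/-- Abstract label of an ordered pair: low with a depth, middle with a position, high with a depth. -/
inductive Lab : Type
  | no : Lab
  | lo : ℕ → Lab
  | mid : ℕ → Lab
  | hi : ℕ → Lab

def Lab.sg : Lab → ℤ
  | .no => 0
  | .lo _ => -1
  | .mid _ => 0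
  | .hi _ => 1

def Lab.sd : Lab → ℤ
  | .no => 0
  | .lo d => -(d : ℤ)
  | .mid _ => 0
  | .hi d => d

def Lab.md : Lab → ℕ
  | .no => 0
  | .lo _ => 0
  | .mid _ => 1
  | .hi _ => 0

/-- decode an integer position into an abstract label -/
def dec (a : ℕ) (z : ℤ) : Lab :=
  if z < 0 then .lo (-1 - z).toNat else if z < a then .mid z.toNat else .hi (z - a).toNat

def LS {W : Type} (a : ℕ) (f : W → W → Lab) (v : W) : Set ℤ := {z | ∃ w, f v w = dec a z}

theorem dec_lo (a d : ℕ) : dec a (-1 - (d : ℤ)) = .lo d := by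
  unfold dec; rw [if_pos (by omega)]; congr 1; omega

theorem dec_mid (a j : ℕ) (h : j < a) : dec a (j : ℤ) = .mid j := by
  unfold dec; rw [if_neg (by omega), if_pos (by omega)]; congr 1

theorem dec_hi (a d : ℕ) : dec a ((a : ℤ) + d) = .hi d := by
  unfold dec; rw [if_neg (by omega), if_neg (by omega)]; congr 1; omega

theorem dec_ne_no (a : ℕ) (z : ℤ) : dec a z ≠ .no := by
  unfold dec; split_ifs <;> simp

theorem dec_inj (a : ℕ) {y z : ℤ} (h : dec a y = dec a z) : y = z := by
  unfold dec at h
  split_ifs at h <;> simp at h <;> omega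

structure Good {W : Type} [Fintype W] (Λ a : ℕ) (f : W → W → Lab) : Prop where
  symm : ∀ x y, f x y = f y x
  diag : ∀ x, f x x = .no
  sg : ∀ v, ∑ w, (f v w).sg = 0
  sd : ∀ v, ∑ w, (f v w).sd = 0
  md : ∀ v, ∑ w, (f v w).md ≤ 3
  surj : ∀ z : ℤ, -(Λ : ℤ) ≤ z → z < a + Λ → ∃ x y, f x y = dec a z
  card : Fintype.card W * (Fintype.card W - 1) = 2 * (2 * Λ + a)

structure GoodIn {W : Type} [Fintype W] (Λ a : ℕ) (f : W → W → Lab) : Prop extends Good Λ a f where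
  offd : ∀ x y, x ≠ y → f x y ≠ .no
  inj : ∀ x y x' y', f x y ≠ .no → f x y = f x' y' → s(x, y) = s(x', y')
  rng : ∀ v z, z ∈ LS a f v → -(Λ : ℤ) ≤ z ∧ z < a + Λ

def IvFam (p m : ℕ) (l : ℤ) (S : Set ℤ) (F : List (ℤ × ℤ)) : Prop :=
  F.length ≤ m ∧ (∀ I ∈ F, I.1 + 2 * p ≤ I.2 ∧ ∀ z, I.1 ≤ z → z < I.2 → z ∈ S) ∧
  F.Pairwise (fun I J => I.2 ≤ J.1 ∨ J.2 ≤ I.1) ∧ l ≤ (F.map fun I => I.2 - I.1).sum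

theorem IvFam.perm {p m : ℕ} {l : ℤ} {S : Set ℤ} {F G : List (ℤ × ℤ)} (h : IvFam p m l S F)
    (hp : F.Perm G) : IvFam p m l S G := by
  obtain ⟨h1, h2, h3, h4⟩ := h
  refine ⟨hp.length_eq ▸ h1, fun I hI => h2 I (hp.mem_iff.2 hI), ?_, ?_⟩
  · refine (hp.pairwise_iff ?_).1 h3
    intro x y hxy; exact hxy.symm
  · rw [← (hp.map _).sum_eq]; exact h4

theorem IvFam.extract {p m : ℕ} {l : ℤ} {S : Set ℤ} {F : List (ℤ × ℤ)} (h : IvFam p m l S F)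
    {I : ℤ × ℤ} (hI : I ∈ F) : ∃ G, IvFam p m l S (I :: G) ∧ ∀ J ∈ G, J ∈ F := by
  classical
  exact ⟨_, h.perm (List.perm_cons_erase hI), fun J hJ => List.mem_of_mem_erase hJ⟩

theorem build (p m m' : ℕ) (l : ℤ) (S' : Set ℤ) (g : ℤ → ℤ)
    (gexp : ∀ x y, x ≤ y → y - x ≤ g y - g x) (F0 E : List (ℤ × ℤ))
    (hF : ∀ J ∈ F0, J.1 + 2 * p ≤ J.2 ∧ ∀ z, J.1 ≤ z → z < J.2 → g z = g J.1 + (z - J.1) ∧ g z ∈ S')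
    (hFp : F0.Pairwise (fun I J => I.2 ≤ J.1 ∨ J.2 ≤ I.1))
    (hE : ∀ J ∈ E, J.1 + 2 * p ≤ J.2 ∧ ∀ z, J.1 ≤ z → z < J.2 → z ∈ S')
    (hEp : E.Pairwise (fun I J => I.2 ≤ J.1 ∨ J.2 ≤ I.1))
    (hc : ∀ J ∈ F0, ∀ e ∈ E, e.2 ≤ g J.1 ∨ g J.1 + (J.2 - J.1) ≤ e.1)
    (hlen : F0.length ≤ m) (hm : m + E.length ≤ m')
    (hs : l ≤ (F0.map fun I => I.2 - I.1).sum + (E.map fun I => I.2 - I.1).sum) :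
    ∃ G, IvFam p m' l S' G := by
  refine ⟨F0.map (fun J => (g J.1, g J.1 + (J.2 - J.1))) ++ E, ?_, ?_, ?_, ?_⟩
  · simp; omega
  · intro I hI
    rw [List.mem_append, List.mem_map] at hI
    rcases hI with ⟨J, hJ, rfl⟩ | hI
    · obtain ⟨h1, h2⟩ := hF J hJ
      refine ⟨by simp only; omega, fun z hz1 hz2 => ?_⟩
      simp only at hz1 hz2
      obtain ⟨e1, e2⟩ := h2 (z - g J.1 + J.1) (by omega) (by omega)
      have : g (z - g J.1 + J.1) = z := by omega
      rwa [this] at e2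
    · exact hE I hI
  · rw [List.pairwise_append]
    refine ⟨?_, hEp, ?_⟩
    · rw [List.pairwise_map]
      refine hFp.imp_of_mem ?_
      intro I J hI hJ h
      have hI1 := (hF I hI).1
      have hJ1 := (hF J hJ).1
      rcases h with h | h
      · left
        simp only
        by_cases h' : I.1 ≤ J.1
        · have := gexp _ _ h'; omega
        · have := gexp _ _ (not_le.1 h').le; omega
      · right
        simp only
        by_cases h' : J.1 ≤ I.1
        · have := gexp _ _ h'; omega
        · have := gexp _ _ (not_le.1 h').le; omega
    · intro I hI e he
      rw [List.mem_map] at hI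
      obtain ⟨J, hJ, rfl⟩ := hI
      have := hc J hJ e he
      simp only
      omega
  · rw [List.map_append, List.sum_append, List.map_map]
    have : ((fun I : ℤ × ℤ => I.2 - I.1) ∘
        fun J : ℤ × ℤ => (g J.1, g J.1 + (J.2 - J.1))) = fun I : ℤ × ℤ => I.2 - I.1 := by
      funext J; simp
    rw [this]; exact hs

abbrev Al (q : ℕ) : Type := Bool × Bool × Fin q

/-- The properties required of the two halves of the bipartite part. -/
structure BipGood (q : ℕ) (h : Al q → Al q → Bool) (y : Al q → Al q → ℕ) : Prop where
  lt : ∀ r c, y r c < 8 * q * q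
  surj : ∀ b k, k < 8 * q * q → ∃ r c, h r c = b ∧ y r c = k
  rowsg : ∀ r, ∑ c, (if h r c then (1 : ℤ) else -1) = 0
  rowsy : ∀ r, ∑ c, (if h r c then (y r c : ℤ) else -(y r c : ℤ)) = 0
  colsg : ∀ c, ∑ r, (if h r c then (1 : ℤ) else -1) = 0
  colsy : ∀ c, ∑ r, (if h r c then (y r c : ℤ) else -(y r c : ℤ)) = 0
  rowrun : ∀ r b, ∃ s, ∀ k, s ≤ k → k < s + q → ∃ c, h r c = b ∧ y r c = k
  colrun : ∀ c b, ∃ s, ∀ k, s ≤ k → k < s + q → ∃ r, h r c = b ∧ y r c = k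

def cpos (q j i : ℕ) : ℕ := if j = 1 then q - 1 - i else i

def bipH (q : ℕ) (r c : Al q) : Bool := xor r.2.1 c.2.1

def bipY (q : ℕ) (R C : Bool → Bool → Bool → ℕ → ℕ) (r c : Al q) : ℕ :=
  if r.1 = c.1 then q * R (bipH q r c) r.1 r.2.1 r.2.2 + c.2.2
  else q * C (bipH q r c) c.1 c.2.1 c.2.2 + cpos q c.2.2 r.2.2

theorem cpos_lt (q j i : ℕ) (h : i < q) : cpos q j i < q := by
  unfold cpos; split_ifs <;> omega

theorem cpos_cpos (q j i : ℕ) (h : i < q) : cpos q j (cpos q j i) = i := by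
  unfold cpos; split_ifs <;> omega

theorem divrange_aux (q n k : ℕ) (h1 : q * n ≤ k) (h2 : k < q * n + q) :
    k - q * n < q ∧ q * n + (k - q * n) = k := by omega

theorem bipGood_of (q : ℕ) (R C : Bool → Bool → Bool → ℕ → ℕ)
    (hR : ∀ b a1 a2 i, i < q → R b a1 a2 i < 8 * q)
    (hC : ∀ b a1 a2 i, i < q → C b a1 a2 i < 8 * q)
    (hs : ∀ b n, n < 8 * q → ∃ a1 a2 i, i < q ∧ (R b a1 a2 i = n ∨ C b a1 a2 i = n))
    (hrow : ∀ a1 a2 i, i < q → (q : ℤ) * (R true a1 a2 i) + ∑ j ∈ range q, (C true (!a1) (!a2) j : ℤ)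
      = q * (R false a1 a2 i) + ∑ j ∈ range q, (C false (!a1) a2 j : ℤ))
    (hcol : ∀ b1 b2 j, j < q → (q : ℤ) * (C true b1 b2 j) + ∑ i ∈ range q, (R true b1 (!b2) i : ℤ)
      = q * (C false b1 b2 j) + ∑ i ∈ range q, (R false b1 b2 i : ℤ)) :
    BipGood q (bipH q) (bipY q R C) := by
  have key : ∀ n o : ℕ, n < 8 * q → o < q → q * n + o < 8 * q * q := by
    intro n o hn ho
    have : q * (n + 1) ≤ q * (8 * q) := Nat.mul_le_mul_left q hn
    nlinarith
  constructor
  · rintro ⟨a1, a2, i⟩ ⟨b1, b2, j⟩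
    unfold bipY
    split_ifs
    · exact key _ _ (hR _ _ _ _ i.2) j.2
    · exact key _ _ (hC _ _ _ _ j.2) (cpos_lt _ _ _ i.2)
  · intro b k hk
    have hq : 0 < q := by
      rcases Nat.eq_zero_or_pos q with h | h
      · subst h; simp at hk
      · exact h
    obtain ⟨a1, a2, i, hi, h⟩ := hs b (k / q) (by
      rw [Nat.div_lt_iff_lt_mul hq]; exact hk)
    have hm := Nat.mod_lt k hq
    have hd := Nat.div_add_mod k q
    rcases h with h | h
    · refine ⟨(a1, a2, ⟨i, hi⟩), (a1, xor a2 b, ⟨k % q, hm⟩), ?_, ?_⟩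
      · cases a2 <;> cases b <;> rfl
      · have e : bipH q (a1, a2, ⟨i, hi⟩) (a1, xor a2 b, ⟨k % q, hm⟩) = b := by
          cases a2 <;> cases b <;> rfl
        unfold bipY
        rw [e]; simp [h, hd]
    · have e : bipH q (!a1, xor a2 b, ⟨cpos q i (k % q), cpos_lt _ _ _ hm⟩) (a1, a2, ⟨i, hi⟩) = b := by
          cases a2 <;> cases b <;> rfl
      refine ⟨(!a1, xor a2 b, ⟨cpos q i (k % q), cpos_lt _ _ _ hm⟩), (a1, a2, ⟨i, hi⟩), e, ?_⟩
      unfold bipY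
      rw [e]; simp [h, cpos_cpos _ _ _ hm, hd]
  · rintro ⟨a1, a2, i⟩
    simp only [Fintype.sum_prod_type, Fintype.sum_bool, bipH]
    cases a2 <;> simp
  · rintro ⟨a1, a2, i⟩
    have := hrow a1 a2 i i.2
    simp only [Finset.sum_range] at this
    simp only [Fintype.sum_prod_type, Fintype.sum_bool, bipH, bipY]
    cases a1 <;> cases a2 <;>
      simp [Finset.sum_add_distrib, ← Finset.mul_sum] at this ⊢ <;> linear_combination (q : ℤ) * this
  · rintro ⟨b1, b2, j⟩
    simp only [Fintype.sum_prod_type, Fintype.sum_bool, bipH]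
    cases b2 <;> simp
  · rintro ⟨b1, b2, j⟩
    have := hcol b1 b2 j j.2
    simp only [Finset.sum_range] at this
    simp only [Fintype.sum_prod_type, Fintype.sum_bool, bipH, bipY]
    cases b1 <;> cases b2 <;>
      simp [Finset.sum_add_distrib, ← Finset.mul_sum] at this ⊢ <;> linear_combination (q : ℤ) * this
  · rintro ⟨a1, a2, i⟩ b
    refine ⟨q * R b a1 a2 i, fun k h1 h2 => ?_⟩
    obtain ⟨h3, h4⟩ := divrange_aux _ _ _ h1 h2
    have e : bipH q (a1, a2, i) (a1, xor a2 b, ⟨_, h3⟩) = b := by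
      cases a2 <;> cases b <;> rfl
    refine ⟨(a1, xor a2 b, ⟨_, h3⟩), e, ?_⟩
    unfold bipY
    rw [e]; simp only [if_true]; exact h4
  · rintro ⟨b1, b2, j⟩ b
    refine ⟨q * C b b1 b2 j, fun k h1 h2 => ?_⟩
    obtain ⟨h3, h4⟩ := divrange_aux _ _ _ h1 h2
    have e : bipH q (!b1, xor b2 b, ⟨cpos q j _, cpos_lt _ _ _ h3⟩) (b1, b2, j) = b := by
      cases b2 <;> cases b <;> rfl
    refine ⟨(!b1, xor b2 b, ⟨cpos q j _, cpos_lt _ _ _ h3⟩), e, ?_⟩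
    unfold bipY
    rw [e]; simp [cpos_cpos _ _ _ h3]; omega

def pick (n0 n1 : ℕ) (g : ℕ → ℕ) (i : ℕ) : ℕ := if i = 0 then n0 else if i = 1 then n1 else g i

def aR (q : ℕ) : Bool → Bool → ℕ → ℕ
  | false, false => pick 0 7 (fun i => 4 + 4 * i)
  | false, true => pick 3 10 (fun i => 7 + 4 * i)
  | true, false => pick 8 (8 * q - 2) (fun i => 4 * q - 3 + 4 * i)
  | true, true => pick 9 (8 * q - 1) (fun i => 4 * q - 2 + 4 * i)

def aC (q : ℕ) : Bool → Bool → ℕ → ℕ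
  | true, false => pick 1 11 (fun i => 4 * q - 1 + 4 * i)
  | true, true => pick 4 2 (fun i => 4 * q - 4 + 4 * i)
  | false, true => pick 5 (8 * q - 4) (fun i => 5 + 4 * i)
  | false, false => pick 6 (8 * q - 3) (fun i => 6 + 4 * i)

def AR (q : ℕ) (b a1 a2 : Bool) : ℕ → ℕ := aR q a1 (xor b a2)
def AC (q : ℕ) (_ b1 b2 : Bool) : ℕ → ℕ := aC q b1 b2

theorem aC_sum1 (q : ℕ) (hq : 2 ≤ q) (n : ℕ) :
    ∑ j ∈ range (n + 2), (aC q true false j : ℤ) = ∑ j ∈ range (n + 2), (aC q true true j : ℤ) + 3 * (n + 2) := by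
  induction n with
  | zero => simp [Finset.sum_range_succ, aC, pick]
  | succ n ih =>
    rw [Finset.sum_range_succ, Finset.sum_range_succ _ (n + 2), ih]
    have e : aC q true false (n + 2) = aC q true true (n + 2) + 3 := by
      simp only [aC, pick]
      split_ifs <;> first | contradiction | omega
    rw [e]; push_cast; ring

theorem aC_sum2 (q : ℕ) (hq : 2 ≤ q) (n : ℕ) :
    ∑ j ∈ range (n + 2), (aC q false false j : ℤ) = ∑ j ∈ range (n + 2), (aC q false true j : ℤ) + (n + 2) := by
  induction n with
  | zero => simp [Finset.sum_range_succ, aC, pick]; omega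
  | succ n ih =>
    rw [Finset.sum_range_succ, Finset.sum_range_succ _ (n + 2), ih]
    simp only [aC, pick]
    split_ifs <;> omega

theorem a_surj (q : ℕ) (hq : 2 ≤ q) (n : ℕ) (hn : n < 8 * q) :
    ∃ a1 a2 i, i < q ∧ (aR q a1 a2 i = n ∨ aC q a1 a2 i = n) := by
  have h4 : n % 4 = 0 ∨ n % 4 = 1 ∨ n % 4 = 2 ∨ n % 4 = 3 := by omega
  by_cases h : n < 12
  · interval_cases n
    · exact ⟨false, false, 0, by omega, .inl rfl⟩
    · exact ⟨true, false, 0, by omega, .inr rfl⟩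
    · exact ⟨true, true, 1, by omega, .inr rfl⟩
    · exact ⟨false, true, 0, by omega, .inl rfl⟩
    · exact ⟨true, true, 0, by omega, .inr rfl⟩
    · exact ⟨false, true, 0, by omega, .inr rfl⟩
    · exact ⟨false, false, 0, by omega, .inr rfl⟩
    · exact ⟨false, false, 1, by omega, .inl rfl⟩
    · exact ⟨true, false, 0, by omega, .inl rfl⟩
    · exact ⟨true, true, 0, by omega, .inl rfl⟩
    · exact ⟨false, true, 1, by omega, .inl rfl⟩
    · exact ⟨true, false, 1, by omega, .inr rfl⟩
  by_cases h' : n < 4 * q + 4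
  · have e0 : ¬ (n - 4) / 4 = 0 := by omega
    have e1 : ¬ (n - 4) / 4 = 1 := by omega
    rcases h4 with h4 | h4 | h4 | h4
    · exact ⟨false, false, (n - 4) / 4, by omega, .inl (by simp only [aR, pick, e0, e1, if_false]; omega)⟩
    · exact ⟨false, true, (n - 4) / 4, by omega, .inr (by simp only [aC, pick, e0, e1, if_false]; omega)⟩
    · exact ⟨false, false, (n - 4) / 4, by omega, .inr (by simp only [aC, pick, e0, e1, if_false]; omega)⟩
    · exact ⟨false, true, (n - 4) / 4, by omega, .inl (by simp only [aR, pick, e0, e1, if_false]; omega)⟩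
  by_cases h'' : n < 8 * q - 4
  · have e0 : ¬ (n - 4 * q + 4) / 4 = 0 := by omega
    have e1 : ¬ (n - 4 * q + 4) / 4 = 1 := by omega
    rcases h4 with h4 | h4 | h4 | h4
    · exact ⟨true, true, (n - 4 * q + 4) / 4, by omega, .inr (by simp only [aC, pick, e0, e1, if_false]; omega)⟩
    · exact ⟨true, false, (n - 4 * q + 4) / 4, by omega, .inl (by simp only [aR, pick, e0, e1, if_false]; omega)⟩
    · exact ⟨true, true, (n - 4 * q + 4) / 4, by omega, .inl (by simp only [aR, pick, e0, e1, if_false]; omega)⟩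
    · exact ⟨true, false, (n - 4 * q + 4) / 4, by omega, .inr (by simp only [aC, pick, e0, e1, if_false]; omega)⟩
  rcases h4 with h4 | h4 | h4 | h4
  · exact ⟨false, true, 1, by omega, .inr (by simp [aC, pick]; omega)⟩
  · exact ⟨false, false, 1, by omega, .inr (by simp [aC, pick]; omega)⟩
  · exact ⟨true, false, 1, by omega, .inl (by simp [aR, pick]; omega)⟩
  · exact ⟨true, true, 1, by omega, .inl (by simp [aR, pick]; omega)⟩

theorem aR_diff (q : ℕ) (hq : 2 ≤ q) (i : ℕ) : aR q false true i = aR q false false i + 3 ∧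
    aR q true true i = aR q true false i + 1 := by
  simp only [aR, pick]
  split_ifs <;> omega

theorem a_lt (q : ℕ) (hq : 2 ≤ q) (a1 a2 : Bool) (i : ℕ) (hi : i < q) :
    aR q a1 a2 i < 8 * q ∧ aC q a1 a2 i < 8 * q := by
  cases a1 <;> cases a2 <;> simp only [aR, aC, pick] <;> split_ifs <;> omega

theorem bipA_good (q : ℕ) (hq : 2 ≤ q) : BipGood q (bipH q) (bipY q (AR q) (AC q)) := by
  refine bipGood_of q _ _ (fun b a1 a2 i hi => (a_lt q hq a1 _ i hi).1)
    (fun b a1 a2 i hi => (a_lt q hq a1 _ i hi).2) ?_ ?_ ?_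
  · intro b n hn
    obtain ⟨a1, a2, i, hi, h | h⟩ := a_surj q hq n hn
    · exact ⟨a1, xor b a2, i, hi, .inl (by simp [AR, h])⟩
    · exact ⟨a1, a2, i, hi, .inr h⟩
  · intro a1 a2 i hi
    obtain ⟨n, rfl⟩ : ∃ n, q = n + 2 := ⟨q - 2, by omega⟩
    have h1 := aC_sum1 (n + 2) hq n
    have h2 := aC_sum2 (n + 2) hq n
    obtain ⟨h3, h4⟩ := aR_diff (n + 2) hq i
    cases a1 <;> cases a2 <;>
      simp only [AR, AC, Bool.not_true, Bool.not_false, Bool.xor_true, Bool.xor_false, Bool.xor_self, h1, h2, h3, h4] <;>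
      push_cast <;> ring
  · intro b1 b2 j hj
    cases b1 <;> cases b2 <;> simp [AR, AC]

/-- presence of value `k` with flag `b` in a row / column -/
def RowHas (q : ℕ) (h : Al q → Al q → Bool) (y : Al q → Al q → ℕ) (r : Al q) (b : Bool) (s e : ℕ) : Prop :=
  ∀ k, s ≤ k → k < e → ∃ c, h r c = b ∧ y r c = k
def ColHas (q : ℕ) (h : Al q → Al q → Bool) (y : Al q → Al q → ℕ) (c : Al q) (b : Bool) (s e : ℕ) : Prop :=
  ∀ k, s ≤ k → k < e → ∃ r, h r c = b ∧ y r c = k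

theorem rowHas_R (q : ℕ) (R C : Bool → Bool → Bool → ℕ → ℕ) (a1 a2 : Bool) (i : Fin q) (b : Bool) (n : ℕ)
    (hn : R b a1 a2 i = n) (k : ℕ) (h1 : q * n ≤ k) (h2 : k < q * n + q) :
    ∃ c, bipH q (a1, a2, i) c = b ∧ bipY q R C (a1, a2, i) c = k := by
  obtain ⟨h3, h4⟩ := divrange_aux _ _ _ h1 h2
  have e : bipH q (a1, a2, i) (a1, xor a2 b, ⟨_, h3⟩) = b := by
    cases a2 <;> cases b <;> rfl
  refine ⟨(a1, xor a2 b, ⟨_, h3⟩), e, ?_⟩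
  unfold bipY
  rw [e]; simp only [if_true, hn]; exact h4

theorem rowHas_C (q : ℕ) (R C : Bool → Bool → Bool → ℕ → ℕ) (a1 a2 : Bool) (i : Fin q) (b : Bool) (j : Fin q) (k : ℕ)
    (hk : q * C b (!a1) (xor a2 b) j + cpos q j i = k) :
    ∃ c, bipH q (a1, a2, i) c = b ∧ bipY q R C (a1, a2, i) c = k := by
  have e : bipH q (a1, a2, i) (!a1, xor a2 b, j) = b := by
    cases a2 <;> cases b <;> rfl
  refine ⟨(!a1, xor a2 b, j), e, ?_⟩
  unfold bipY
  rw [e]; simp [hk]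

theorem colHas_C (q : ℕ) (R C : Bool → Bool → Bool → ℕ → ℕ) (b1 b2 : Bool) (j : Fin q) (b : Bool) (n : ℕ)
    (hn : C b b1 b2 j = n) (k : ℕ) (h1 : q * n ≤ k) (h2 : k < q * n + q) :
    ∃ r, bipH q r (b1, b2, j) = b ∧ bipY q R C r (b1, b2, j) = k := by
  obtain ⟨h3, h4⟩ := divrange_aux _ _ _ h1 h2
  have e : bipH q (!b1, xor b2 b, ⟨cpos q j _, cpos_lt _ _ _ h3⟩) (b1, b2, j) = b := by
    cases b2 <;> cases b <;> rfl
  refine ⟨(!b1, xor b2 b, ⟨cpos q j _, cpos_lt _ _ _ h3⟩), e, ?_⟩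
  unfold bipY
  rw [e]; simp [cpos_cpos _ _ _ h3, hn]; omega

theorem colHas_R (q : ℕ) (R C : Bool → Bool → Bool → ℕ → ℕ) (b1 b2 : Bool) (j : Fin q) (b : Bool) (i : Fin q) (k : ℕ)
    (hk : q * R b b1 (xor b2 b) i + j = k) :
    ∃ r, bipH q r (b1, b2, j) = b ∧ bipY q R C r (b1, b2, j) = k := by
  have e : bipH q (b1, xor b2 b, i) (b1, b2, j) = b := by
    cases b2 <;> cases b <;> rfl
  refine ⟨(b1, xor b2 b, i), e, ?_⟩
  unfold bipY
  rw [e]; simp [hk]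

theorem bipA_row0 (q : ℕ) (hq : 2 ≤ q) :
    RowHas q (bipH q) (bipY q (AR q) (AC q)) (false, false, ⟨0, by omega⟩) false 0 (q + 1) ∧
    RowHas q (bipH q) (bipY q (AR q) (AC q)) (false, false, ⟨0, by omega⟩) true (3 * q - 1) (4 * q + 1) := by
  refine ⟨fun k h1 h2 => ?_, fun k h1 h2 => ?_⟩
  · by_cases h : k < q
    · exact rowHas_R q _ _ _ _ _ _ 0 rfl k (by omega) (by omega)
    · exact rowHas_C q _ _ _ _ _ _ ⟨0, by omega⟩ k (by simp [AC, aC, pick, cpos]; omega)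
  · by_cases h : k < 3 * q
    · exact rowHas_C q _ _ _ _ _ _ ⟨1, by omega⟩ k (by simp [AC, aC, pick, cpos]; omega)
    by_cases h' : k < 4 * q
    · exact rowHas_R q _ _ _ _ _ _ 3 rfl k (by omega) (by omega)
    · exact rowHas_C q _ _ _ _ _ _ ⟨0, by omega⟩ k (by simp [AC, aC, pick, cpos]; omega)

theorem bipA_row1 (q : ℕ) (hq : 2 ≤ q) :
    RowHas q (bipH q) (bipY q (AR q) (AC q)) (false, true, ⟨0, by omega⟩) true 0 (q + 1) ∧
    RowHas q (bipH q) (bipY q (AR q) (AC q)) (false, true, ⟨0, by omega⟩) false (3 * q - 1) (4 * q + 1) := by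
  refine ⟨fun k h1 h2 => ?_, fun k h1 h2 => ?_⟩
  · by_cases h : k < q
    · exact rowHas_R q _ _ _ _ _ _ 0 rfl k (by omega) (by omega)
    · exact rowHas_C q _ _ _ _ _ _ ⟨0, by omega⟩ k (by simp [AC, aC, pick, cpos]; omega)
  · by_cases h : k < 3 * q
    · exact rowHas_C q _ _ _ _ _ _ ⟨1, by omega⟩ k (by simp [AC, aC, pick, cpos]; omega)
    by_cases h' : k < 4 * q
    · exact rowHas_R q _ _ _ _ _ _ 3 rfl k (by omega) (by omega)
    · exact rowHas_C q _ _ _ _ _ _ ⟨0, by omega⟩ k (by simp [AC, aC, pick, cpos]; omega)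

theorem bipA_col0 (q : ℕ) (hq : 2 ≤ q) (b : Bool) :
    ColHas q (bipH q) (bipY q (AR q) (AC q)) (false, false, ⟨0, by omega⟩) b (6 * q) (7 * q + 1) := by
  intro k h1 h2
  by_cases h' : k < 7 * q
  · exact colHas_C q _ _ _ _ _ _ 6 (by simp [AC, aC, pick]) k (by omega) (by omega)
  · exact colHas_R q _ _ _ _ _ _ ⟨1, by omega⟩ k (by cases b <;> simp [AR, aR, pick] <;> omega)

def vr (q i : ℕ) : ℕ := if q % 2 = 1 ∧ q ≤ i + 2 then 1 else 0

def bR0 (q i : ℕ) : ℕ := if i = q / 2 then 4 * i + 1 else 4 * i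
def bC2 (q i : ℕ) : ℕ := if i = q / 2 then 4 * i else 4 * i + 1
def bR1 (q i : ℕ) : ℕ :=
  if i = 0 then 4 * (q / 2) + 3 else if i = q / 2 then 4 * i + 2 else 4 * i + 2 + vr q i
def bC3 (q i : ℕ) : ℕ :=
  if i = 0 then 2 else if i = 1 then 3 else if i = q / 2 then 7 else 4 * i + 3 - vr q i

def BR (q : ℕ) : Bool → Bool → Bool → ℕ → ℕ
  | false, false, false => bR0 q
  | false, false, true => bR1 q
  | false, true, true => fun i => 4 * q + 4 * i + 1
  | false, true, false => fun i => 4 * q + 4 * i + 3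
  | true, false, false => fun i => bR0 q i + 2
  | true, false, true => fun i => bR1 q i - 2
  | true, true, true => fun i => 4 * q + 4 * i + 1
  | true, true, false => fun i => 4 * q + 4 * i + 3

def BC (q : ℕ) : Bool → Bool → Bool → ℕ → ℕ
  | false, true, false => bC2 q
  | false, true, true => bC3 q
  | false, false, true => fun i => 4 * q + 4 * i
  | false, false, false => fun i => 4 * q + 4 * i + 2
  | true, true, false => fun i => bC2 q i + 2
  | true, true, true => fun i => bC3 q i - 2
  | true, false, true => fun i => 4 * q + 4 * i + 2
  | true, false, false => fun i => 4 * q + 4 * i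

theorem b_ge (q i : ℕ) : 2 ≤ bR1 q i ∧ 2 ≤ bC3 q i := by
  unfold bR1 bC3 vr; split_ifs <;> first | contradiction | omega

theorem bC_sum (q : ℕ) (hq : 4 ≤ q) :
    ∑ i ∈ range q, (bC3 q i : ℤ) = ∑ i ∈ range q, (bC2 q i : ℤ) := by
  rw [← sub_eq_zero, ← Finset.sum_sub_distrib]
  have : ∀ i ∈ range q, (bC3 q i : ℤ) - bC2 q i = 2 + (if i = 0 then -1 else 0)
      + (if i = 1 then -4 else 0) + (if i = q / 2 then 5 - 4 * ((q / 2 : ℕ) : ℤ) else 0)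
      + (if i = q - 2 then -((q % 2 : ℕ) : ℤ) else 0) + (if i = q - 1 then -((q % 2 : ℕ) : ℤ) else 0) := by
    intro i hi
    rw [Finset.mem_range] at hi
    unfold bC3 bC2 vr
    split_ifs <;> first | contradiction | omega
  rw [Finset.sum_congr rfl this]
  simp only [Finset.sum_add_distrib, Finset.sum_ite_eq', Finset.mem_range, Finset.sum_const, Finset.card_range]
  rw [if_pos (by omega), if_pos (by omega), if_pos (by omega), if_pos (by omega), if_pos (by omega)]
  simp only [nsmul_eq_mul]
  omega

theorem bR_sum (q : ℕ) (hq : 4 ≤ q) :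
    ∑ i ∈ range q, (bR1 q i : ℤ) = ∑ i ∈ range q, (bR0 q i : ℤ) + 4 * q := by
  rw [← sub_eq_iff_eq_add', ← Finset.sum_sub_distrib]
  have : ∀ i ∈ range q, (bR1 q i : ℤ) - bR0 q i = 2 + (if i = 0 then 4 * ((q / 2 : ℕ) : ℤ) + 1 else 0)
      + (if i = q / 2 then -1 else 0)
      + (if i = q - 2 then ((q % 2 : ℕ) : ℤ) else 0) + (if i = q - 1 then ((q % 2 : ℕ) : ℤ) else 0) := by
    intro i hi
    rw [Finset.mem_range] at hi
    unfold bR1 bR0 vr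
    split_ifs <;> first | contradiction | omega
  rw [Finset.sum_congr rfl this]
  simp only [Finset.sum_add_distrib, Finset.sum_ite_eq', Finset.mem_range, Finset.sum_const, Finset.card_range]
  rw [if_pos (by omega), if_pos (by omega), if_pos (by omega), if_pos (by omega)]
  simp only [nsmul_eq_mul]
  omega

/-- low order: pair (0,1) of block `k` -/
theorem b_pair01 (q : ℕ) (k o : ℕ) (ho : o < 2) :
    bR0 q k = 4 * k + o ∨ bC2 q k = 4 * k + o := by
  unfold bR0 bC2; split_ifs <;> first | contradiction | omega

theorem b_pair23 (q : ℕ) (hq : 4 ≤ q) (k o : ℕ) (hk : k < q) (ho : o < 2) :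
    ∃ i < q, bR1 q i = 4 * k + 2 + o ∨ bC3 q i = 4 * k + 2 + o := by
  by_cases h0 : k = 0
  · subst h0
    interval_cases o
    · exact ⟨0, by omega, .inr (by simp [bC3])⟩
    · exact ⟨1, by omega, .inr (by simp [bC3])⟩
  by_cases h1 : k = 1
  · subst h1
    interval_cases o
    · refine ⟨1, by omega, .inl ?_⟩
      unfold bR1 vr; split_ifs <;> first | contradiction | omega
    · refine ⟨q / 2, by omega, .inr ?_⟩
      unfold bC3; split_ifs <;> first | contradiction | omega
  by_cases h2 : k = q / 2
  · interval_cases o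
    · refine ⟨k, by omega, .inl ?_⟩
      unfold bR1; split_ifs <;> first | contradiction | omega
    · refine ⟨0, by omega, .inl ?_⟩
      unfold bR1; split_ifs <;> first | contradiction | omega
  refine ⟨k, hk, ?_⟩
  unfold bR1 bC3 vr
  split_ifs <;> first | contradiction | omega

theorem b_bd (q : ℕ) (hq : 4 ≤ q) (i : ℕ) (hi : i < q) :
    bR0 q i + 2 < 8 * q ∧ bR1 q i + 2 < 8 * q ∧ bC2 q i + 2 < 8 * q ∧ bC3 q i + 2 < 8 * q := by
  unfold bR0 bR1 bC2 bC3 vr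
  refine ⟨?_, ?_, ?_, ?_⟩ <;> split_ifs <;> omega

theorem bipB_good (q : ℕ) (hq : 4 ≤ q) : BipGood q (bipH q) (bipY q (BR q) (BC q)) := by
  refine bipGood_of q _ _ ?_ ?_ ?_ ?_ ?_
  · intro b a1 a2 i hi
    have hbd := b_bd q hq i hi
    cases b <;> cases a1 <;> cases a2 <;> simp only [BR] <;> omega
  · intro b a1 a2 i hi
    have hbd := b_bd q hq i hi
    cases b <;> cases a1 <;> cases a2 <;> simp only [BC] <;> omega
  · intro b n hn
    by_cases hb : n < 4 * q
    · by_cases h : n % 4 < 2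
      · cases b
        · rcases b_pair01 q (n / 4) (n % 4) h with e | e
          · exact ⟨false, false, n / 4, by omega, .inl (by simp only [BR]; omega)⟩
          · exact ⟨true, false, n / 4, by omega, .inr (by simp only [BC]; omega)⟩
        · obtain ⟨i, hi, e | e⟩ := b_pair23 q hq (n / 4) (n % 4) (by omega) h
          · exact ⟨false, true, i, hi, .inl (by simp only [BR]; omega)⟩
          · exact ⟨true, true, i, hi, .inr (by simp only [BC]; omega)⟩
      · cases b
        · obtain ⟨i, hi, e | e⟩ := b_pair23 q hq (n / 4) (n % 4 - 2) (by omega) (by omega)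
          · exact ⟨false, true, i, hi, .inl (by simp only [BR]; omega)⟩
          · exact ⟨true, true, i, hi, .inr (by simp only [BC]; omega)⟩
        · rcases b_pair01 q (n / 4) (n % 4 - 2) (by omega) with e | e
          · exact ⟨false, false, n / 4, by omega, .inl (by simp only [BR]; omega)⟩
          · exact ⟨true, false, n / 4, by omega, .inr (by simp only [BC]; omega)⟩
    · have h4 : n % 4 = 0 ∨ n % 4 = 1 ∨ n % 4 = 2 ∨ n % 4 = 3 := by omega
      rcases h4 with h4 | h4 | h4 | h4
      · exact ⟨false, !b, n / 4 - q, by omega, .inr (by cases b <;> simp only [BC, Bool.not_true, Bool.not_false] <;> omega)⟩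
      · exact ⟨true, true, n / 4 - q, by omega, .inl (by cases b <;> simp only [BR] <;> omega)⟩
      · exact ⟨false, b, n / 4 - q, by omega, .inr (by cases b <;> simp only [BC] <;> omega)⟩
      · exact ⟨true, false, n / 4 - q, by omega, .inl (by cases b <;> simp only [BR] <;> omega)⟩
  · have hs := bC_sum q hq
    have e3 : ∑ i ∈ range q, ((bC3 q i - 2 : ℕ) : ℤ) = ∑ i ∈ range q, (bC3 q i : ℤ) - 2 * q := by
      rw [Finset.sum_congr rfl (fun i _ => Nat.cast_sub (b_ge q i).2)]
      simp [Finset.sum_sub_distrib]; ring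
    have e2 : ∑ i ∈ range q, ((bC2 q i + 2 : ℕ) : ℤ) = ∑ i ∈ range q, (bC2 q i : ℤ) + 2 * q := by
      simp [Finset.sum_add_distrib]; ring
    intro a1 a2 i hi
    have h1 := (b_ge q i).1
    cases a1 <;> cases a2 <;> simp only [BR, BC, Bool.not_true, Bool.not_false]
    · rw [e3]; push_cast; linear_combination hs
    · rw [e2, Nat.cast_sub h1]; push_cast; linear_combination -hs
  · have hs := bR_sum q hq
    have e1 : ∑ i ∈ range q, ((bR1 q i - 2 : ℕ) : ℤ) = ∑ i ∈ range q, (bR1 q i : ℤ) - 2 * q := by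
      rw [Finset.sum_congr rfl (fun i _ => Nat.cast_sub (b_ge q i).1)]
      simp [Finset.sum_sub_distrib]; ring
    have e0 : ∑ i ∈ range q, ((bR0 q i + 2 : ℕ) : ℤ) = ∑ i ∈ range q, (bR0 q i : ℤ) + 2 * q := by
      simp [Finset.sum_add_distrib]; ring
    have e23 : ∑ i ∈ range q, ((4 * q + 4 * i + 3 : ℕ) : ℤ) = ∑ i ∈ range q, ((4 * q + 4 * i + 1 : ℕ) : ℤ) + 2 * q := by
      have : ∀ i ∈ range q, ((4 * q + 4 * i + 3 : ℕ) : ℤ) = ((4 * q + 4 * i + 1 : ℕ) : ℤ) + 2 := by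
        intro i _; push_cast; ring
      rw [Finset.sum_congr rfl this, Finset.sum_add_distrib]; simp; ring
    intro b1 b2 j hj
    have h1 := (b_ge q j).2
    cases b1 <;> cases b2 <;> simp only [BR, BC, Bool.not_true, Bool.not_false]
    · rw [e1]; push_cast; linear_combination hs
    · rw [e0]; push_cast; linear_combination -hs
    · rw [e23]; push_cast; ring
    · rw [e23, Nat.cast_sub h1]; push_cast; ring

theorem bipB_row0 (q : ℕ) (hq : 4 ≤ q) :
    RowHas q (bipH q) (bipY q (BR q) (BC q)) (false, false, ⟨0, by omega⟩) false 0 (q + 1) ∧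
    RowHas q (bipH q) (bipY q (BR q) (BC q)) (false, false, ⟨0, by omega⟩) true 0 1 ∧
    RowHas q (bipH q) (bipY q (BR q) (BC q)) (false, false, ⟨0, by omega⟩) true (2 * q - 1) (3 * q) := by
  have hz : ¬ 0 = q / 2 := by omega
  refine ⟨fun k h1 h2 => ?_, fun k h1 h2 => ?_, fun k h1 h2 => ?_⟩
  · by_cases h : k < q
    · exact rowHas_R q _ _ _ _ _ _ 0 (by simp only [BR, bR0]; rw [if_neg hz]) k (by omega) (by omega)
    · refine rowHas_C q _ _ _ _ _ _ ⟨0, by omega⟩ k ?_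
      simp only [BC, bC2, cpos, Bool.not_false, Bool.xor_false]; rw [if_neg hz, if_neg (by omega)]; omega
  · refine rowHas_C q _ _ _ _ _ _ ⟨0, by omega⟩ k ?_
    simp [BC, bC3, cpos]; omega
  · by_cases h : k < 2 * q
    · refine rowHas_C q _ _ _ _ _ _ ⟨1, by omega⟩ k ?_
      simp [BC, bC3, cpos]; omega
    · exact rowHas_R q _ _ _ _ _ _ 2 (by simp only [BR, bR0]; rw [if_neg hz]) k (by omega) (by omega)

theorem Good.slo {W : Type} [Fintype W] {Λ a : ℕ} {f : W → W → Lab} (h : Good Λ a f) (d : ℕ) (hd : d < Λ) :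
    ∃ x y, f x y = .lo d := by
  obtain ⟨x, y, e⟩ := h.surj (-1 - d) (by omega) (by omega)
  exact ⟨x, y, by rw [e, dec_lo]⟩

theorem Good.smid {W : Type} [Fintype W] {Λ a : ℕ} {f : W → W → Lab} (h : Good Λ a f) (d : ℕ) (hd : d < a) :
    ∃ x y, f x y = .mid d := by
  obtain ⟨x, y, e⟩ := h.surj d (by omega) (by omega)
  exact ⟨x, y, by rw [e, dec_mid _ _ hd]⟩

theorem Good.shi {W : Type} [Fintype W] {Λ a : ℕ} {f : W → W → Lab} (h : Good Λ a f) (d : ℕ) (hd : d < Λ) :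
    ∃ x y, f x y = .hi d := by
  obtain ⟨x, y, e⟩ := h.surj (a + d) (by omega) (by omega)
  exact ⟨x, y, by rw [e, dec_hi]⟩

theorem surj_of {W : Type} {Λ a : ℕ} {f : W → W → Lab} (h1 : ∀ d < Λ, ∃ x y, f x y = .lo d)
    (h2 : ∀ d < a, ∃ x y, f x y = .mid d) (h3 : ∀ d < Λ, ∃ x y, f x y = .hi d) :
    ∀ z : ℤ, -(Λ : ℤ) ≤ z → z < a + Λ → ∃ x y, f x y = dec a z := by
  intro z hz1 hz2
  unfold dec
  split_ifs
  · exact h1 _ (by omega)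
  · exact h2 _ (by omega)
  · exact h3 _ (by omega)

theorem Good.comp {W V : Type} [Fintype W] [Fintype V] {Λ a : ℕ} {f : W → W → Lab} (h : Good Λ a f) (φ : V ≃ W) :
    Good Λ a (fun x y => f (φ x) (φ y)) where
  symm x y := h.symm _ _
  diag x := h.diag _
  sg v := by rw [← h.sg (φ v)]; exact Equiv.sum_comp φ (fun w => (f (φ v) w).sg)
  sd v := by rw [← h.sd (φ v)]; exact Equiv.sum_comp φ (fun w => (f (φ v) w).sd)
  md v := by
    refine le_of_eq_of_le ?_ (h.md (φ v)); exact Equiv.sum_comp φ (fun w => (f (φ v) w).md)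
  surj z h1 h2 := by
    obtain ⟨x, y, e⟩ := h.surj z h1 h2
    exact ⟨φ.symm x, φ.symm y, by simpa using e⟩
  card := by rw [Fintype.card_congr φ]; exact h.card

theorem LS_comp {W V : Type} {a : ℕ} {f : W → W → Lab} (φ : V ≃ W) (v : V) :
    LS a (fun x y => f (φ x) (φ y)) v = LS a f (φ v) := by
  ext z
  constructor
  · rintro ⟨w, e⟩; exact ⟨φ w, e⟩
  · rintro ⟨w, e⟩; exact ⟨φ.symm w, by simpa using e⟩

def m1 (a c : ℕ) : Lab → Lab
  | .no => .no
  | .lo d => .lo d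
  | .mid j => .mid (if j < c then j else j + a)
  | .hi d => .hi d

def m2 (c D : ℕ) : Lab → Lab
  | .no => .no
  | .lo d => .lo (d + D)
  | .mid j => .mid (j + c)
  | .hi d => .hi (d + D)

def bl (D : ℕ) (b : Bool) (y : ℕ) : Lab := if b then .hi (D - 1 - y) else .lo (D - 1 - y)

def gA (a c : ℕ) (z : ℤ) : ℤ := if z < c then z else z + a
def gB (a c D : ℕ) (z : ℤ) : ℤ := if z < 0 then z - D else if z < a then z + c else z + a + D

theorem m1_dec (a c : ℕ) (hc : c ≤ a) (z : ℤ) : m1 a c (dec a z) = dec (2 * a) (gA a c z) := by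
  unfold dec gA
  split_ifs <;> simp only [m1] <;> first | (exfalso; omega) | (congr 1; omega) | (congr 1; split_ifs <;> omega)

theorem m2_dec (a c D : ℕ) (hc : c ≤ a) (z : ℤ) : m2 c D (dec a z) = dec (2 * a) (gB a c D z) := by
  unfold dec gB
  split_ifs <;> simp only [m2] <;> first | (exfalso; omega) | (congr 1; omega)

def asm {α : Type} (a c D : ℕ) (f1 f2 : α → α → Lab) (h : α → α → Bool) (y : α → α → ℕ) :
    α ⊕ α → α ⊕ α → Lab
  | .inl x, .inl x' => m1 a c (f1 x x')
  | .inr x, .inr x' => m2 c D (f2 x x')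
  | .inl x, .inr r => bl D (h r x) (y r x)
  | .inr r, .inl x => bl D (h r x) (y r x)

theorem m1_sg (a c : ℕ) (l : Lab) : (m1 a c l).sg = l.sg := by cases l <;> rfl
theorem m1_sd (a c : ℕ) (l : Lab) : (m1 a c l).sd = l.sd := by cases l <;> rfl
theorem m1_md (a c : ℕ) (l : Lab) : (m1 a c l).md = l.md := by cases l <;> rfl
theorem m2_sg (D c : ℕ) (l : Lab) : (m2 c D l).sg = l.sg := by cases l <;> rfl
theorem m2_sd (D c : ℕ) (l : Lab) : (m2 c D l).sd = l.sd + D * l.sg := by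
  cases l <;> simp [m2, Lab.sd, Lab.sg]; ring
theorem m2_md (D c : ℕ) (l : Lab) : (m2 c D l).md = l.md := by cases l <;> rfl
theorem bl_sg (D : ℕ) (b : Bool) (y : ℕ) : (bl D b y).sg = if b then 1 else -1 := by
  cases b <;> rfl
theorem bl_md (D : ℕ) (b : Bool) (y : ℕ) : (bl D b y).md = 0 := by
  cases b <;> rfl
theorem bl_sd (D : ℕ) (b : Bool) (y : ℕ) (h : y < D) : (bl D b y).sd =
    ((D : ℤ) - 1) * (if b then 1 else -1) - (if b then (y : ℤ) else -(y : ℤ)) := by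
  cases b <;> simp [bl, Lab.sd] <;> omega

theorem asm_good {q Λ a c : ℕ} (hc : c ≤ a) {f1 f2 : Al q → Al q → Lab}
    (g1 : Good Λ a f1) (g2 : Good Λ a f2) {h : Al q → Al q → Bool} {y : Al q → Al q → ℕ}
    (hb : BipGood q h y) :
    Good (2 * Λ + 8 * q * q) (2 * a) (asm a c (Λ + 8 * q * q) f1 f2 h y) where
  symm x x' := by
    rcases x with x | x <;> rcases x' with x' | x' <;> simp [asm, g1.symm x, g2.symm x]
  diag x := by
    rcases x with x | x <;> simp [asm, g1.diag x, g2.diag x, m1, m2]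
  sg v := by
    rcases v with v | v <;> simp [asm, m1_sg, m2_sg, bl_sg, g1.sg v, g2.sg v]
    · exact hb.colsg v
    · exact hb.rowsg v
  sd v := by
    have hlt : ∀ r c, y r c < Λ + 8 * q * q := fun r c => by have := hb.lt r c; omega
    rcases v with v | v <;>
      simp only [Fintype.sum_sum_type, asm, m1_sd, m2_sd, bl_sd _ _ _ (hlt _ _), Finset.sum_add_distrib,
        Finset.sum_sub_distrib, ← Finset.mul_sum, g1.sd v, g2.sd v, g2.sg v]
    · rw [hb.colsg v, hb.colsy v]; simp
    · rw [hb.rowsg v, hb.rowsy v]; simp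
  md v := by
    have h1 := g1.md
    have h2 := g2.md
    rcases v with v | v <;> simp [asm, m1_md, m2_md, bl_md, h1, h2]
  surj := by
    apply surj_of
    · intro d hd
      by_cases h1 : d < Λ
      · obtain ⟨x, y, e⟩ := g1.slo d h1
        exact ⟨.inl x, .inl y, by simp [asm, e, m1]⟩
      by_cases h2 : d < Λ + 8 * q * q
      · obtain ⟨r, x, e1, e2⟩ := hb.surj false (Λ + 8 * q * q - 1 - d) (by omega)
        exact ⟨.inr r, .inl x, by simp [asm, e1, e2, bl]; omega⟩
      · obtain ⟨x, y, e⟩ := g2.slo (d - (Λ + 8 * q * q)) (by omega)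
        exact ⟨.inr x, .inr y, by simp [asm, e, m2]; omega⟩
    · intro d hd
      by_cases h1 : d < c
      · obtain ⟨x, y, e⟩ := g1.smid d (by omega)
        exact ⟨.inl x, .inl y, by simp [asm, e, m1, h1]⟩
      by_cases h2 : d < c + a
      · obtain ⟨x, y, e⟩ := g2.smid (d - c) (by omega)
        exact ⟨.inr x, .inr y, by simp [asm, e, m2]; omega⟩
      · obtain ⟨x, y, e⟩ := g1.smid (d - a) (by omega)
        exact ⟨.inl x, .inl y, by
          simp only [asm, e, m1]; rw [if_neg (by omega)]; congr 1; omega⟩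
    · intro d hd
      by_cases h1 : d < Λ
      · obtain ⟨x, y, e⟩ := g1.shi d h1
        exact ⟨.inl x, .inl y, by simp [asm, e, m1]⟩
      by_cases h2 : d < Λ + 8 * q * q
      · obtain ⟨r, x, e1, e2⟩ := hb.surj true (Λ + 8 * q * q - 1 - d) (by omega)
        exact ⟨.inr r, .inl x, by simp [asm, e1, e2, bl]; omega⟩
      · obtain ⟨x, y, e⟩ := g2.shi (d - (Λ + 8 * q * q)) (by omega)
        exact ⟨.inr x, .inr y, by simp [asm, e, m2]; omega⟩
  card := by
    have := g1.card
    simp only [Fintype.card_sum, Fintype.card_prod, Fintype.card_bool, Fintype.card_fin] at this ⊢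
    rcases Nat.eq_zero_or_pos q with rfl | hq
    · simp at this ⊢; omega
    · zify at this ⊢
      rw [Nat.cast_sub (by omega)] at this ⊢
      push_cast at this ⊢
      linear_combination 2 * this

section
variable {q a c D : ℕ} {f1 f2 : Al q → Al q → Lab} {h : Al q → Al q → Bool} {y : Al q → Al q → ℕ}

theorem asm_LS1 (hc : c ≤ a) {x : Al q} {z : ℤ} (hz : z ∈ LS a f1 x) :
    gA a c z ∈ LS (2 * a) (asm a c D f1 f2 h y) (.inl x) := by
  obtain ⟨w, e⟩ := hz
  exact ⟨.inl w, by simp only [asm, e, m1_dec a c hc]⟩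

theorem asm_LS2 (hc : c ≤ a) {x : Al q} {z : ℤ} (hz : z ∈ LS a f2 x) :
    gB a c D z ∈ LS (2 * a) (asm a c D f1 f2 h y) (.inr x) := by
  obtain ⟨w, e⟩ := hz
  exact ⟨.inr w, by simp only [asm, e, m2_dec a c D hc]⟩

/-- position of a bipartite value -/
def bz (a D : ℕ) (b : Bool) (k : ℕ) : ℤ := if b then 2 * a + D - 1 - k else (k : ℤ) - D

theorem bl_dec {k : ℕ} (hk : k < D) (b : Bool) : bl D b k = dec (2 * a) (bz a D b k) := by
  cases b
  · have : bz a D false k = -1 - ((D - 1 - k : ℕ) : ℤ) := by simp [bz]; omega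
    rw [this, dec_lo]; rfl
  · have : bz a D true k = ((2 * a : ℕ) : ℤ) + ((D - 1 - k : ℕ) : ℤ) := by simp [bz]; omega
    rw [this, dec_hi]; rfl

theorem asm_LSr {r : Al q} {b : Bool} {k : ℕ} (hk : k < D) (hz : ∃ x, h r x = b ∧ y r x = k) :
    bz a D b k ∈ LS (2 * a) (asm a c D f1 f2 h y) (.inr r) := by
  obtain ⟨x, e1, e2⟩ := hz
  exact ⟨.inl x, by simp only [asm, e1, e2]; exact bl_dec hk b⟩

theorem asm_LSc {x : Al q} {b : Bool} {k : ℕ} (hk : k < D) (hz : ∃ r, h r x = b ∧ y r x = k) :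
    bz a D b k ∈ LS (2 * a) (asm a c D f1 f2 h y) (.inl x) := by
  obtain ⟨r, e1, e2⟩ := hz
  exact ⟨.inr r, by simp only [asm, e1, e2]; exact bl_dec hk b⟩

theorem asm_cut (hc1 : 1 ≤ c) (hc : c ≤ a) (v : Al q ⊕ Al q) :
    ¬ (((c : ℤ) - 1) ∈ LS (2 * a) (asm a c D f1 f2 h y) v ∧ (c : ℤ) ∈ LS (2 * a) (asm a c D f1 f2 h y) v) := by
  have e1 : dec (2 * a) ((c : ℤ) - 1) = .mid (c - 1) := by
    have := dec_mid (2 * a) (c - 1) (by omega)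
    rwa [Nat.cast_sub hc1] at this
  have e2 : dec (2 * a) (c : ℤ) = .mid c := dec_mid (2 * a) c (by omega)
  rintro ⟨⟨w, h1⟩, ⟨w', h2⟩⟩
  rw [e1] at h1
  rw [e2] at h2
  rcases v with x | r
  · rcases w' with x' | r'
    · simp only [asm] at h2
      cases e : f1 x x' with
      | mid j => 
        simp only [e, m1, Lab.mid.injEq] at h2
        split_ifs at h2 <;> omega
      | _ => simp [e, m1] at h2
    · simp only [asm, bl] at h2
      split_ifs at h2
  · rcases w with x' | r'
    · simp only [asm, bl] at h1
      split_ifs at h1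
    · simp only [asm] at h1
      cases e : f2 r r' with
      | mid j => 
        simp only [e, m2, Lab.mid.injEq] at h1
        omega
      | _ => simp [e, m2] at h1

end

theorem gA_exp (a c : ℕ) (x y : ℤ) (h : x ≤ y) : y - x ≤ gA a c y - gA a c x := by
  unfold gA; split_ifs <;> omega

theorem gB_exp (a c D : ℕ) (hc : c ≤ a) (x y : ℤ) (h : x ≤ y) : y - x ≤ gB a c D y - gB a c D x := by
  unfold gB; split_ifs <;> omega

theorem IvFam.extract2 {p m : ℕ} {l : ℤ} {S : Set ℤ} {F : List (ℤ × ℤ)} (h : IvFam p m l S F)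
    {I I' : ℤ × ℤ} (hI : I ∈ F) (hI' : I' ∈ F) (hne : I' ≠ I) : ∃ G, IvFam p m l S (I :: I' :: G) ∧ ∀ J ∈ G, J ∈ F := by
  classical
  have h1 := List.perm_cons_erase hI
  have h2 : I' ∈ F.erase I := (List.mem_erase_of_ne hne).2 hI'
  exact ⟨_, h.perm (h1.trans ((List.perm_cons_erase h2).cons I)),
    fun J hJ => List.mem_of_mem_erase (List.mem_of_mem_erase hJ)⟩

/-- all integers of the half-open interval lie in the set -/
def Sub (s e : ℤ) (S : Set ℤ) : Prop := ∀ z, s ≤ z → z < e → z ∈ S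

theorem core1 {p m' Λ a c : ℕ} {l : ℤ} {N : ℕ} {S S' : Set ℤ}
    (hS : ∀ z ∈ S, gA a c z ∈ S' ∧ -(Λ : ℤ) ≤ z ∧ z < a + Λ) (hp : 0 < p)
    (F0 : List (ℤ × ℤ)) (hF : ∀ J ∈ F0, J.1 + 2 * p ≤ J.2 ∧ Sub J.1 J.2 S ∧ ¬ (J.1 < c ∧ c < J.2))
    (hFp : F0.Pairwise (fun I J => I.2 ≤ J.1 ∨ J.2 ≤ I.1)) 
    {D sl el sh eh : ℕ} (hD : D = Λ + N) (hel : el ≤ N) (heh : eh ≤ N)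
    (h1 : Sub (sl - D) (el - D) S') (h2 : Sub (2 * a + D - eh) (2 * a + D - sh) S')
    (hl : sl + 2 * p ≤ el) (hh : sh + 2 * p ≤ eh) (hm : F0.length + 2 ≤ m')
    (hs : l ≤ (F0.map fun I => I.2 - I.1).sum + (el - sl) + (eh - sh)) :
    ∃ G, IvFam p m' l S' G := by
  refine build p F0.length m' l S' (gA a c) (gA_exp a c) F0
    [((sl : ℤ) - D, (el : ℤ) - D), (2 * (a : ℤ) + D - eh, 2 * (a : ℤ) + D - sh)] ?_ hFp ?_ ?_ ?_ le_rfl (by simpa using hm) ?_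
  · intro J hJ
    obtain ⟨e1, e2, e3⟩ := hF J hJ
    refine ⟨e1, fun z hz1 hz2 => ⟨?_, (hS z (e2 z hz1 hz2)).1⟩⟩
    unfold gA; split_ifs <;> omega
  · intro J hJ
    simp only [List.mem_cons, List.not_mem_nil, or_false] at hJ
    rcases hJ with rfl | rfl
    · exact ⟨by simp only; omega, h1⟩
    · exact ⟨by simp only; omega, h2⟩
  · simp; omega
  · intro J hJ e he
    obtain ⟨e1, e2, e3⟩ := hF J hJ
    have hA := (hS _ (e2 J.1 le_rfl (by omega))).2
    have hB := (hS _ (e2 (J.2 - 1) (by omega) (by omega))).2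
    simp only [List.mem_cons, List.not_mem_nil, or_false] at he
    unfold gA
    rcases he with rfl | rfl <;> split_ifs <;> simp only <;> omega
  · simp; linarith

theorem core2 {p m' a c D : ℕ} {l : ℤ} {S S' : Set ℤ}
    (hS : ∀ z ∈ S, gB a c D z ∈ S')
    (F0 E : List (ℤ × ℤ)) (hF : ∀ J ∈ F0, J.1 + 2 * p ≤ J.2 ∧ Sub J.1 J.2 S ∧ ¬ (J.1 < 0 ∧ 0 < J.2) ∧ ¬ (J.1 < a ∧ a < J.2))
    (hFp : F0.Pairwise (fun I J => I.2 ≤ J.1 ∨ J.2 ≤ I.1)) (hc : c ≤ a)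
    (hE : ∀ J ∈ E, J.1 + 2 * p ≤ J.2 ∧ Sub J.1 J.2 S')
    (hEp : E.Pairwise (fun I J => I.2 ≤ J.1 ∨ J.2 ≤ I.1))
    (hx : ∀ J ∈ F0, ∀ e ∈ E, e.2 ≤ gB a c D J.1 ∨ gB a c D J.1 + (J.2 - J.1) ≤ e.1)
    (hm : F0.length + E.length ≤ m')
    (hs : l ≤ (F0.map fun I => I.2 - I.1).sum + (E.map fun I => I.2 - I.1).sum) :
    ∃ G, IvFam p m' l S' G := by
  refine build p F0.length m' l S' (gB a c D) (gB_exp a c D hc) F0 E ?_ hFp hE hEp hx le_rfl hm hs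
  intro J hJ
  obtain ⟨e1, e2, e3⟩ := hF J hJ
  refine ⟨e1, fun z hz1 hz2 => ⟨?_, hS z (e2 z hz1 hz2)⟩⟩
  unfold gB; split_ifs <;> omega

/-- generic first-copy vertex -/
theorem V1 {p m q Λ a c : ℕ} {l : ℤ} {N : ℕ} {S S' : Set ℤ}
    (hS : ∀ z ∈ S, gA a c z ∈ S' ∧ -(Λ : ℤ) ≤ z ∧ z < a + Λ) (hp : 0 < p) (hpq : 2 * p ≤ q)
    {F : List (ℤ × ℤ)} (hF : IvFam p m l S F) (hn : ∀ J ∈ F, ¬ (J.1 < c ∧ c < J.2)) (hc : c ≤ a)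
    {D sl sh : ℕ} (hD : D = Λ + N) (hel : sl + q ≤ N) (heh : sh + q ≤ N)
    (h1 : Sub (sl - D) ((sl + q : ℕ) - D) S') (h2 : Sub (2 * a + D - (sh + q : ℕ)) (2 * a + D - sh) S') :
    ∃ G, IvFam p (m + 2) (l + 2 * q) S' G := by
  obtain ⟨f1, f2, f3, f4⟩ := hF
  refine core1 hS hp F (fun J hJ => ⟨(f2 J hJ).1, (f2 J hJ).2, hn J hJ⟩) f3 hD hel heh h1 h2
    (by omega) (by omega) (by omega) ?_
  push_cast; linarith

/-- special first-copy vertex: an interval ends just after the cut -/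
theorem V1s {p m q Λ a c : ℕ} {l : ℤ} {N : ℕ} {S S' : Set ℤ}
    (hS : ∀ z ∈ S, gA a c z ∈ S' ∧ -(Λ : ℤ) ≤ z ∧ z < a + Λ) (hp : 0 < p) (hpq : 2 * p ≤ q)
    {F : List (ℤ × ℤ)} (hF : IvFam p m l S F) (I : ℤ × ℤ) (hI : I ∈ F) (hIc : I.1 < c) (hIe : I.2 = c + 1)
    (hI2 : I.1 + 2 * p + 1 ≤ I.2 ∨ p = 1) (hc : c ≤ a)
    {D sl sh : ℕ} (hD : D = Λ + N) (hel : sl + q + 1 ≤ N) (heh : sh + q + 1 ≤ N)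
    (h1 : Sub (sl - D) ((sl + q + 1 : ℕ) - D) S') (h2 : Sub (2 * a + D - (sh + q + 1 : ℕ)) (2 * a + D - sh) S') :
    ∃ G, IvFam p (m + 2) (l + 2 * q) S' G := by
  obtain ⟨G, ⟨f1, f2, f3, f4⟩, -⟩ := hF.extract hI
  simp only [List.length_cons, List.mem_cons, forall_eq_or_imp, List.pairwise_cons, List.map_cons, List.sum_cons] at f1 f2 f3 f4
  obtain ⟨⟨i1, i2⟩, f2⟩ := f2
  obtain ⟨f3, f3'⟩ := f3
  have hG : ∀ J ∈ G, J.1 + 2 * p ≤ J.2 ∧ Sub J.1 J.2 S ∧ ¬ (J.1 < c ∧ c < J.2) := by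
    intro J hJ
    refine ⟨(f2 J hJ).1, (f2 J hJ).2, ?_⟩
    have := f3 J hJ
    omega
  by_cases h : I.1 + 2 * p + 1 ≤ I.2
  · refine core1 hS hp ((I.1, (c : ℤ)) :: G) ?_ ?_ hD hel heh h1 h2 (by omega) (by omega) (by simp; omega) ?_
    · intro J hJ
      rw [List.mem_cons] at hJ
      rcases hJ with rfl | hJ
      · exact ⟨by simp only; omega, fun z hz1 hz2 => i2 z hz1 (by simp only at hz2; omega), by simp only; omega⟩
      · exact hG J hJ
    · rw [List.pairwise_cons]
      refine ⟨fun J hJ => ?_, f3'⟩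
      have := f3 J hJ
      simp only; omega
    · simp only [List.map_cons, List.sum_cons]; push_cast; linarith
  · refine core1 hS hp G hG f3' hD hel heh h1 h2 (by omega) (by omega) (by omega) ?_
    push_cast; omega

/-- generic second-copy vertex -/
theorem V2 {p m q Λ a c : ℕ} {l : ℤ} {N : ℕ} {S S' : Set ℤ}
    {D sl sh : ℕ} (hS : ∀ z ∈ S, gB a c D z ∈ S') (hpq : 2 * p ≤ q)
    {F : List (ℤ × ℤ)} (hF : IvFam p m l S F) (hn : ∀ J ∈ F, ¬ (J.1 < 0 ∧ 0 < J.2) ∧ ¬ (J.1 < a ∧ a < J.2)) (hc : c ≤ a)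
    (hD : D = Λ + N) (hel : sl + q ≤ N) (heh : sh + q ≤ N)
    (h1 : Sub (sl - D) ((sl + q : ℕ) - D) S') (h2 : Sub (2 * a + D - (sh + q : ℕ)) (2 * a + D - sh) S') :
    ∃ G, IvFam p (m + 2) (l + 2 * q) S' G := by
  obtain ⟨f1, f2, f3, f4⟩ := hF
  refine core2 hS F [((sl : ℤ) - D, ((sl + q : ℕ) : ℤ) - D), (2 * (a : ℤ) + D - (sh + q : ℕ), 2 * (a : ℤ) + D - sh)]
    (fun J hJ => ⟨(f2 J hJ).1, (f2 J hJ).2, hn J hJ⟩) f3 hc ?_ ?_ ?_ (by simp; omega) ?_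
  · intro J hJ
    simp only [List.mem_cons, List.not_mem_nil, or_false] at hJ
    rcases hJ with rfl | rfl
    · exact ⟨by simp only; omega, h1⟩
    · exact ⟨by simp only; omega, h2⟩
  · simp; omega
  · intro J hJ e he
    have e3 := hn J hJ
    have e1 := (f2 J hJ).1
    simp only [List.mem_cons, List.not_mem_nil, or_false] at he
    unfold gB
    rcases he with rfl | rfl <;> split_ifs <;> simp only <;> omega
  · simp; linarith

theorem Sub.mono {s e s' e' : ℤ} {S : Set ℤ} (h : Sub s e S) (h1 : s ≤ s') (h2 : e' ≤ e) : Sub s' e' S :=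
  fun z hz1 hz2 => h z (by omega) (by omega)

theorem Sub.union {s e r : ℤ} {S : Set ℤ} (h : Sub s e S) (h' : Sub e r S) : Sub s r S :=
  fun z hz1 hz2 => if h1 : z < e then h z hz1 h1 else h' z (by omega) hz2

theorem low_merge {a c D : ℕ} {S S' : Set ℤ} (hS : ∀ z ∈ S, gB a c D z ∈ S') {i k r : ℤ} (hk : 0 ≤ k)
    (h : Sub i k S) (h' : Sub (-D) r S') : Sub (i - D) r S' := by
  refine Sub.union (e := -D) (fun z hz1 hz2 => ?_) h'
  have := hS (z + D) (h _ (by omega) (by omega))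
  unfold gB at this
  rw [if_pos (by omega)] at this
  simpa using this

theorem high_image {a c D : ℕ} {S S' : Set ℤ} (hS : ∀ z ∈ S, gB a c D z ∈ S') {i k : ℤ} (hi : i ≤ a)
    (h : Sub i k S) : Sub (2 * a + D) (k + a + D) S' := by
  intro z hz1 hz2
  have := hS (z - a - D) (h _ (by omega) (by omega))
  unfold gB at this
  rw [if_neg (by omega), if_neg (by omega)] at this
  convert this using 1; ring

theorem high_merge {a c D : ℕ} {S S' : Set ℤ} (hS : ∀ z ∈ S, gB a c D z ∈ S') {i k r : ℤ} (hi : i ≤ a)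
    (h : Sub i k S) (h' : Sub r (2 * a + D) S') : Sub r (k + a + D) S' :=
  h'.union (high_image hS hi h)

/-- crossing zero only -/
theorem V2lo {p m q Λ a c : ℕ} {l : ℤ} {N : ℕ} {S S' : Set ℤ}
    {D : ℕ} (hS : ∀ z ∈ S, gB a c D z ∈ S') (hpq : 2 * p ≤ q) (hp : 0 < p)
    {F : List (ℤ × ℤ)} (hF : IvFam p m l S F) (I : ℤ × ℤ) (hI : I ∈ F) (hI1 : I.1 < 0) (hI2 : 0 < I.2) (hk : I.2 ≤ 3)
    (hn : ∀ J ∈ F, ¬ (J.1 < a ∧ a < J.2)) (hc : c ≤ a)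
    (hD : D = Λ + N) (hN : 4 * q + 1 ≤ N)
    (h1 : Sub (-D) ((q + 1 : ℕ) - D) S') (h2 : Sub (2 * a + D - (4 * q + 1 : ℕ)) (2 * a + D - (3 * q - 1 : ℕ)) S') :
    ∃ G, IvFam p (m + 2) (l + 2 * q) S' G := by
  obtain ⟨G, ⟨f1, f2, f3, f4⟩, hGF⟩ := hF.extract hI
  simp only [List.length_cons, List.mem_cons, forall_eq_or_imp, List.pairwise_cons, List.map_cons, List.sum_cons] at f1 f2 f3 f4
  obtain ⟨⟨i1, i2⟩, f2⟩ := f2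
  obtain ⟨f3, f3'⟩ := f3
  have hG : ∀ J ∈ G, J.1 + 2 * p ≤ J.2 ∧ Sub J.1 J.2 S ∧ ¬ (J.1 < 0 ∧ 0 < J.2) ∧ ¬ (J.1 < a ∧ a < J.2) := by
    intro J hJ
    refine ⟨(f2 J hJ).1, (f2 J hJ).2, ?_, hn J (hGF J hJ)⟩
    have := f3 J hJ
    omega
  refine core2 hS G [(I.1 - D, ((q + 1 : ℕ) : ℤ) - D), (2 * (a : ℤ) + D - (4 * q + 1 : ℕ), 2 * (a : ℤ) + D - (3 * q - 1 : ℕ))]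
    hG f3' hc ?_ ?_ ?_ (by simp; omega) ?_
  · intro J hJ
    simp only [List.mem_cons, List.not_mem_nil, or_false] at hJ
    rcases hJ with rfl | rfl
    · exact ⟨by simp only; omega, low_merge hS hI2.le i2 h1⟩
    · exact ⟨by simp only; omega, h2⟩
  · simp; omega
  · intro J hJ e he
    have e3 := hG J hJ
    have e1 := f3 J hJ
    simp only [List.mem_cons, List.not_mem_nil, or_false] at he
    unfold gB
    rcases he with rfl | rfl <;> split_ifs <;> simp only <;> omega
  · simp only [List.map_cons, List.sum_cons, List.map_nil, List.sum_nil]; omega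

/-- crossing `a` only -/
theorem V2hi {p m q Λ a c : ℕ} {l : ℤ} {N : ℕ} {S S' : Set ℤ}
    {D : ℕ} (hS : ∀ z ∈ S, gB a c D z ∈ S') (hpq : 2 * p ≤ q) (hp : 0 < p)
    {F : List (ℤ × ℤ)} (hF : IvFam p m l S F) (I : ℤ × ℤ) (hI : I ∈ F) (hI1 : I.1 < a) (hI2 : a < I.2) (hk : a - 3 ≤ I.1)
    (hn : ∀ J ∈ F, ¬ (J.1 < 0 ∧ 0 < J.2)) (hc : c ≤ a)
    (hD : D = Λ + N) (hN : 4 * q + 1 ≤ N)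
    (h1 : Sub (2 * a + D - (q + 1 : ℕ)) (2 * a + D) S') (h2 : Sub ((3 * q - 1 : ℕ) - D) ((4 * q + 1 : ℕ) - D) S') :
    ∃ G, IvFam p (m + 2) (l + 2 * q) S' G := by
  obtain ⟨G, ⟨f1, f2, f3, f4⟩, hGF⟩ := hF.extract hI
  simp only [List.length_cons, List.mem_cons, forall_eq_or_imp, List.pairwise_cons, List.map_cons, List.sum_cons] at f1 f2 f3 f4
  obtain ⟨⟨i1, i2⟩, f2⟩ := f2
  obtain ⟨f3, f3'⟩ := f3
  have hG : ∀ J ∈ G, J.1 + 2 * p ≤ J.2 ∧ Sub J.1 J.2 S ∧ ¬ (J.1 < 0 ∧ 0 < J.2) ∧ ¬ (J.1 < a ∧ a < J.2) := by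
    intro J hJ
    refine ⟨(f2 J hJ).1, (f2 J hJ).2, hn J (hGF J hJ), ?_⟩
    have := f3 J hJ
    omega
  refine core2 hS G [(2 * (a : ℤ) + D - (q + 1 : ℕ), I.2 + a + D), (((3 * q - 1 : ℕ) : ℤ) - D, ((4 * q + 1 : ℕ) : ℤ) - D)]
    hG f3' hc ?_ ?_ ?_ (by simp; omega) ?_
  · intro J hJ
    simp only [List.mem_cons, List.not_mem_nil, or_false] at hJ
    rcases hJ with rfl | rfl
    · exact ⟨by simp only; omega, high_merge hS hI1.le i2 h1⟩
    · exact ⟨by simp only; omega, h2⟩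
  · simp; omega
  · intro J hJ e he
    have e3 := hG J hJ
    have e1 := f3 J hJ
    simp only [List.mem_cons, List.not_mem_nil, or_false] at he
    unfold gB
    rcases he with rfl | rfl <;> split_ifs <;> simp only <;> omega
  · simp only [List.map_cons, List.sum_cons, List.map_nil, List.sum_nil]; omega

/-- crossing both, case `p = 1` -/
theorem V2both1 {m q Λ a c : ℕ} {l : ℤ} {N : ℕ} {S S' : Set ℤ}
    {D : ℕ} (hS : ∀ z ∈ S, gB a c D z ∈ S') (hpq : 2 ≤ q)
    {F : List (ℤ × ℤ)} (hF : IvFam 1 m l S F) (I I' : ℤ × ℤ) (hI : I ∈ F) (hI' : I' ∈ F) (hne : I' ≠ I)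
    (hI1 : I.1 < 0) (hI2 : 0 < I.2) (hk : I.2 ≤ 2)
    (hI1' : I'.1 = a - 1) (hI2' : a < I'.2) (hc : c ≤ a)
    (hD : D = Λ + N) (hN : 4 * q + 1 ≤ N)
    (h1 : Sub (-D) ((q + 1 : ℕ) - D) S') (h2 : Sub (2 * a + D - (4 * q + 1 : ℕ)) (2 * a + D - (3 * q - 1 : ℕ)) S') :
    ∃ G, IvFam 1 (m + 2) (l + 2 * q) S' G := by
  obtain ⟨G, ⟨f1, f2, f3, f4⟩, hGF⟩ := hF.extract2 hI hI' hne
  simp only [List.length_cons, List.mem_cons, forall_eq_or_imp, List.pairwise_cons, List.map_cons, List.sum_cons] at f1 f2 f3 f4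
  obtain ⟨⟨i1, i2⟩, ⟨i1', i2'⟩, f2⟩ := f2
  obtain ⟨⟨f3, f3a⟩, f3b, f3'⟩ := f3
  have hG : ∀ J ∈ G, J.1 + 2 * (1 : ℕ) ≤ J.2 ∧ Sub J.1 J.2 S ∧ ¬ (J.1 < 0 ∧ 0 < J.2) ∧ ¬ (J.1 < a ∧ a < J.2) := by
    intro J hJ
    refine ⟨(f2 J hJ).1, (f2 J hJ).2, ?_⟩
    have := f3a J hJ
    have := f3b J hJ
    omega
  obtain ⟨E1, hE1, hE1l, hE1s⟩ : ∃ E1 : List (ℤ × ℤ), (∀ e ∈ E1, I.2 = 2 ∧ e = ((c : ℤ), (c : ℤ) + 2)) ∧ E1.length ≤ 1 ∧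
      E1.Pairwise (fun I J => I.2 ≤ J.1 ∨ J.2 ≤ I.1) ∧ 2 * I.2 - 2 ≤ (E1.map fun I => I.2 - I.1).sum := by
    by_cases h : I.2 = 2
    · exact ⟨[((c : ℤ), (c : ℤ) + 2)], by simp [h], by simp, by simp, by simp; omega⟩
    · exact ⟨[], by simp, by simp, by simp, by simp; omega⟩
  obtain ⟨E2, hE2, hE2l, hE2s⟩ : ∃ E2 : List (ℤ × ℤ), (∀ e ∈ E2, a + 2 ≤ I'.2 ∧ e = (2 * (a : ℤ) + D, I'.2 + a + D)) ∧ E2.length ≤ 1 ∧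
      E2.Pairwise (fun I J => I.2 ≤ J.1 ∨ J.2 ≤ I.1) ∧ I'.2 - I'.1 - 2 ≤ (E2.map fun I => I.2 - I.1).sum := by
    by_cases h : a + 2 ≤ I'.2
    · exact ⟨[(2 * (a : ℤ) + D, I'.2 + a + D)], by simp [h], by simp, by simp, by simp; omega⟩
    · exact ⟨[], by simp, by simp, by simp, by simp; omega⟩
  refine core2 hS G ((I.1 - D, ((q + 1 : ℕ) : ℤ) - D) :: (2 * (a : ℤ) + D - (4 * q + 1 : ℕ), 2 * (a : ℤ) + D - (3 * q - 1 : ℕ)) ::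
      (E1 ++ E2)) hG f3' hc ?_ ?_ ?_ (by simp; omega) ?_
  · intro J hJ
    simp only [List.mem_cons, List.mem_append] at hJ
    rcases hJ with rfl | rfl | hJ | hJ
    · exact ⟨by simp only; omega, low_merge hS hI2.le i2 h1⟩
    · exact ⟨by simp only; omega, h2⟩
    · obtain ⟨h, rfl⟩ := hE1 J hJ
      refine ⟨by simp only; omega, fun z hz1 hz2 => ?_⟩
      simp only at hz1 hz2
      have := hS (z - c) (i2 _ (by omega) (by omega))
      unfold gB at this
      rw [if_neg (by omega), if_pos (by omega)] at this
      simpa using this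
    · obtain ⟨h, rfl⟩ := hE2 J hJ
      exact ⟨by simp only; omega, high_image hS (by omega) i2'⟩
  · simp only [List.pairwise_cons, List.mem_cons, List.mem_append, List.pairwise_append, forall_eq_or_imp]
    refine ⟨⟨by omega, ?_⟩, ?_, hE1s.1, hE2s.1, ?_⟩
    · rintro J (hJ | hJ)
      · obtain ⟨h, rfl⟩ := hE1 J hJ; simp only; omega
      · obtain ⟨h, rfl⟩ := hE2 J hJ; simp only; omega
    · rintro J (hJ | hJ)
      · obtain ⟨h, rfl⟩ := hE1 J hJ; simp only; omega
      · obtain ⟨h, rfl⟩ := hE2 J hJ; simp only; omega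
    · intro J hJ K hK
      obtain ⟨h, rfl⟩ := hE1 J hJ
      obtain ⟨h, rfl⟩ := hE2 K hK; simp only; omega
  · intro J hJ e he
    have e3 := hG J hJ
    have e1 := f3a J hJ
    have e2 := f3b J hJ
    simp only [List.mem_cons, List.mem_append] at he
    unfold gB
    rcases he with rfl | rfl | he | he
    · split_ifs <;> simp only <;> omega
    · split_ifs <;> simp only <;> omega
    · obtain ⟨h, rfl⟩ := hE1 e he; split_ifs <;> simp only <;> omega
    · obtain ⟨h, rfl⟩ := hE2 e he; split_ifs <;> simp only <;> omega
  · simp only [List.map_cons, List.sum_cons, List.map_append, List.sum_append]; omega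

/-- crossing both, case `p ≥ 2` -/
theorem V2both2 {p m q Λ a c : ℕ} {l : ℤ} {N : ℕ} {S S' : Set ℤ}
    {D : ℕ} (hS : ∀ z ∈ S, gB a c D z ∈ S') (hpq : 2 * p ≤ q) (hp : 0 < p)
    {F : List (ℤ × ℤ)} (hF : IvFam p m l S F) (I I' : ℤ × ℤ) (hI : I ∈ F) (hI' : I' ∈ F) (hne : I' ≠ I)
    (hI1 : I.1 < 0) (hI2 : 0 < I.2) (hk : I.2 ≤ 2)
    (hI1' : I'.1 = a - 1) (hI2' : a < I'.2) (hc : c ≤ a)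
    (hD : D = Λ + N) (hN : 4 * q + 1 ≤ N)
    (h1 : Sub (-D) ((q + 1 : ℕ) - D) S') (h2 : Sub (2 * a + D - (3 * q : ℕ)) (2 * a + D - (2 * q - 1 : ℕ)) S')
    (h3 : Sub (2 * a + D - 1) (2 * a + D) S') :
    ∃ G, IvFam p (m + 2) (l + 2 * q) S' G := by
  obtain ⟨G, ⟨f1, f2, f3, f4⟩, hGF⟩ := hF.extract2 hI hI' hne
  simp only [List.length_cons, List.mem_cons, forall_eq_or_imp, List.pairwise_cons, List.map_cons, List.sum_cons] at f1 f2 f3 f4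
  obtain ⟨⟨i1, i2⟩, ⟨i1', i2'⟩, f2⟩ := f2
  obtain ⟨⟨f3, f3a⟩, f3b, f3'⟩ := f3
  have hG : ∀ J ∈ G, J.1 + 2 * p ≤ J.2 ∧ Sub J.1 J.2 S ∧ ¬ (J.1 < 0 ∧ 0 < J.2) ∧ ¬ (J.1 < a ∧ a < J.2) := by
    intro J hJ
    refine ⟨(f2 J hJ).1, (f2 J hJ).2, ?_⟩
    have := f3a J hJ
    have := f3b J hJ
    omega
  refine core2 hS G [(I.1 - D, ((q + 1 : ℕ) : ℤ) - D), (2 * (a : ℤ) + D - (3 * q : ℕ), 2 * (a : ℤ) + D - (2 * q - 1 : ℕ)),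
      (2 * (a : ℤ) + D - 1, I'.2 + a + D)] hG f3' hc ?_ ?_ ?_ (by simp; omega) ?_
  · intro J hJ
    simp only [List.mem_cons, List.not_mem_nil, or_false] at hJ
    rcases hJ with rfl | rfl | rfl
    · exact ⟨by simp only; omega, low_merge hS hI2.le i2 h1⟩
    · exact ⟨by simp only; omega, h2⟩
    · exact ⟨by simp only; omega, high_merge hS (by omega) i2' h3⟩
  · simp; omega
  · intro J hJ e he
    have e3 := hG J hJ
    have e1 := f3a J hJ
    have e2 := f3b J hJ
    simp only [List.mem_cons, List.not_mem_nil, or_false] at he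
    unfold gB
    rcases he with rfl | rfl | rfl <;> split_ifs <;> simp only <;> omega
  · simp only [List.map_cons, List.sum_cons, List.map_nil, List.sum_nil]; omega

def m3 (c : ℕ) : Lab → Lab
  | .no => .no
  | .lo d => .lo d
  | .mid j => .mid (if j < c then j else j + 6)
  | .hi d => .hi d

theorem m3_sg (c : ℕ) (l : Lab) : (m3 c l).sg = l.sg := by cases l <;> rfl
theorem m3_sd (c : ℕ) (l : Lab) : (m3 c l).sd = l.sd := by cases l <;> rfl
theorem m3_md (c : ℕ) (l : Lab) : (m3 c l).md = l.md := by cases l <;> rfl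

def gC (c : ℕ) (z : ℤ) : ℤ := if z < c then z else z + 6

theorem m3_dec (a c : ℕ) (hc : c ≤ a) (z : ℤ) : m3 c (dec a z) = dec (a + 6) (gC c z) := by
  unfold dec gC
  split_ifs <;> simp only [m3] <;> first | (exfalso; omega) | (congr 1; omega) | (congr 1; split_ifs <;> omega)

theorem gC_exp (c : ℕ) (x y : ℤ) (h : x ≤ y) : y - x ≤ gC c y - gC c x := by
  unfold gC; split_ifs <;> omega

def kk : Fin 4 → Fin 4 → ℕ := ![![0, 0, 1, 2], ![0, 0, 3, 4], ![1, 3, 0, 5], ![2, 4, 5, 0]]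
def shf : Fin 4 → ℕ := ![0, 3, 1, 2]
def flg : Fin 4 → Bool := ![false, false, true, true]

def el (Λ N : ℕ) (s : Bool) (i : ℕ) (j : Fin 4) : Lab :=
  if xor s (flg j) then .hi (Λ + shf j * N + i) else .lo (Λ + shf j * N + i)

def extf {X : Type} (Λ N c : ℕ) (ι : X → Fin N) (f : X ⊕ X → X ⊕ X → Lab) :
    (X ⊕ X) ⊕ Fin 4 → (X ⊕ X) ⊕ Fin 4 → Lab
  | .inl v, .inl w => m3 c (f v w)
  | .inr i, .inr j => if i = j then .no else .mid (c + kk i j)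
  | .inl (.inl x), .inr j => el Λ N false (ι x) j
  | .inl (.inr x), .inr j => el Λ N true (ι x) j
  | .inr j, .inl (.inl x) => el Λ N false (ι x) j
  | .inr j, .inl (.inr x) => el Λ N true (ι x) j

theorem el_sg (Λ N : ℕ) (s : Bool) (i : ℕ) (j : Fin 4) :
    (el Λ N s i j).sg = if xor s (flg j) then 1 else -1 := by
  unfold el; split_ifs <;> rfl
theorem el_sd (Λ N : ℕ) (s : Bool) (i : ℕ) (j : Fin 4) :
    (el Λ N s i j).sd = if xor s (flg j) then ((Λ + shf j * N + i : ℕ) : ℤ) else -((Λ + shf j * N + i : ℕ) : ℤ) := by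
  unfold el; split_ifs <;> rfl
theorem el_md (Λ N : ℕ) (s : Bool) (i : ℕ) (j : Fin 4) : (el Λ N s i j).md = 0 := by
  unfold el; split_ifs <;> rfl

theorem el_surj (Λ N : ℕ) (b : Bool) (d : ℕ) (h1 : Λ ≤ d) (h2 : d < Λ + 4 * N) :
    ∃ s i j, i < N ∧ el Λ N s i j = if b then .hi d else .lo d := by
  have key : ∀ j : Fin 4, Λ + shf j * N ≤ d → d < Λ + shf j * N + N →
      ∃ s i j, i < N ∧ el Λ N s i j = if b then .hi d else .lo d := by
    intro j h3 h4
    refine ⟨xor b (flg j), d - (Λ + shf j * N), j, by omega, ?_⟩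
    unfold el
    have : Λ + shf j * N + (d - (Λ + shf j * N)) = d := by omega
    rw [this]
    cases b <;> cases flg j <;> rfl
  by_cases c1 : d < Λ + N
  · exact key 0 (by simp [shf]; omega) (by simp [shf]; omega)
  by_cases c2 : d < Λ + 2 * N
  · exact key 2 (by simp [shf]; omega) (by simp [shf]; omega)
  by_cases c3 : d < Λ + 3 * N
  · exact key 3 (by simp [shf]; omega) (by simp [shf]; omega)
  · exact key 1 (by simp [shf]; omega) (by simp [shf]; omega)

theorem ext_good {X : Type} [Fintype X] {Λ a N c : ℕ} (ι : X ≃ Fin N) {f : X ⊕ X → X ⊕ X → Lab}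
    (hf : Good Λ a f) (hc : c ≤ a) : Good (Λ + 4 * N) (a + 6) (extf Λ N c ι f) where
  symm x y := by
    rcases x with (x | x) | x <;> rcases y with (y | y) | y <;> simp only [extf]
    any_goals rw [hf.symm]
    fin_cases x <;> fin_cases y <;> rfl
  diag x := by
    rcases x with x | x <;> simp [extf, hf.diag, m3]
  sg v := by
    rcases v with (v | v) | v
    · simp only [Fintype.sum_sum_type (α₁ := X ⊕ X), extf, m3_sg, hf.sg, el_sg]
      simp [Fin.sum_univ_four, flg]
    · simp only [Fintype.sum_sum_type (α₁ := X ⊕ X), extf, m3_sg, hf.sg, el_sg]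
      simp [Fin.sum_univ_four, flg]
    · simp only [Fintype.sum_sum_type, extf, el_sg]
      have : ∑ x : Fin 4, (if v = x then Lab.no else Lab.mid (c + kk v x)).sg = 0 := by
        apply Finset.sum_eq_zero; intro x _; split_ifs <;> rfl
      rw [this]
      cases flg v <;> simp
  sd v := by
    rcases v with (v | v) | v
    · simp only [Fintype.sum_sum_type (α₁ := X ⊕ X), extf, m3_sd, hf.sd, el_sd]
      simp [Fin.sum_univ_four, flg, shf]; ring
    · simp only [Fintype.sum_sum_type (α₁ := X ⊕ X), extf, m3_sd, hf.sd, el_sd]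
      simp [Fin.sum_univ_four, flg, shf]; ring
    · simp only [Fintype.sum_sum_type, extf, el_sd]
      have : ∑ x : Fin 4, (if v = x then Lab.no else Lab.mid (c + kk v x)).sd = 0 := by
        apply Finset.sum_eq_zero; intro x _; split_ifs <;> rfl
      rw [this]
      rw [add_zero, ← Finset.sum_add_distrib]
      apply Finset.sum_eq_zero
      intro x _
      cases flg v
      · simp; ring
      · simp
  md v := by
    rcases v with (v | v) | v
    · simp only [Fintype.sum_sum_type (α₁ := X ⊕ X), extf, m3_md, el_md]
      simpa using hf.md (.inl v)
    · simp only [Fintype.sum_sum_type (α₁ := X ⊕ X), extf, m3_md, el_md]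
      simpa using hf.md (.inr v)
    · simp only [Fintype.sum_sum_type, extf, el_md]
      fin_cases v <;> simp [Fin.sum_univ_four, Lab.md]
  surj := by
    have hel : ∀ (b : Bool) (d : ℕ), Λ ≤ d → d < Λ + 4 * N → ∃ x y, extf Λ N c ι f x y = if b then .hi d else .lo d := by
      intro b d h1 h2
      obtain ⟨s, i, j, hi, e⟩ := el_surj Λ N b d h1 h2
      cases s
      · exact ⟨.inl (.inl (ι.symm ⟨i, hi⟩)), .inr j, by simp only [extf, Equiv.apply_symm_apply, e]⟩
      · exact ⟨.inl (.inr (ι.symm ⟨i, hi⟩)), .inr j, by simp only [extf, Equiv.apply_symm_apply, e]⟩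
    apply surj_of
    · intro d hd
      by_cases h : d < Λ
      · obtain ⟨x, y, e⟩ := hf.slo d h
        exact ⟨.inl x, .inl y, by simp [extf, e, m3]⟩
      · exact hel false d (by omega) hd
    · intro d hd
      by_cases h : d < c
      · obtain ⟨x, y, e⟩ := hf.smid d (by omega)
        exact ⟨.inl x, .inl y, by simp [extf, e, m3, h]⟩
      by_cases h' : c + 6 ≤ d
      · obtain ⟨x, y, e⟩ := hf.smid (d - 6) (by omega)
        exact ⟨.inl x, .inl y, by
          simp only [extf, e, m3]; rw [if_neg (by omega)]; congr 1; omega⟩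
      · obtain ⟨k, rfl⟩ : ∃ k, d = c + k := ⟨d - c, by omega⟩
        have : k < 6 := by omega
        have hk : ∃ i j : Fin 4, i ≠ j ∧ kk i j = k := by
          clear h h' hd
          revert k; decide
        obtain ⟨i, j, hij, hk⟩ := hk
        exact ⟨.inr i, .inr j, by simp [extf, hij, hk]⟩
    · intro d hd
      by_cases h : d < Λ
      · obtain ⟨x, y, e⟩ := hf.shi d h
        exact ⟨.inl x, .inl y, by simp [extf, e, m3]⟩
      · exact hel true d (by omega) hd
  card := by
    have hN : Fintype.card X = N := by rw [Fintype.card_congr ι, Fintype.card_fin]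
    have := hf.card
    simp only [Fintype.card_sum, Fintype.card_fin, hN] at this ⊢
    rcases Nat.eq_zero_or_pos N with h0 | h0
    · rw [h0] at this ⊢; simp at this ⊢; omega
    · zify at this ⊢
      rw [Nat.cast_sub (by omega)] at this ⊢
      push_cast at this ⊢
      linear_combination this

theorem ext_old {X : Type} {Λ a N c : ℕ} (ι : X → Fin N) {f : X ⊕ X → X ⊕ X → Lab} (hc : c ≤ a) (v : X ⊕ X)
    (hcut : ¬ (((c : ℤ) - 1) ∈ LS a f v ∧ (c : ℤ) ∈ LS a f v)) {p m : ℕ} {l : ℤ}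
    (h : ∃ G, IvFam p m l (LS a f v) G) : ∃ G, IvFam p m l (LS (a + 6) (extf Λ N c ι f) (.inl v)) G := by
  obtain ⟨F, f1, f2, f3, f4⟩ := h
  refine build p F.length m l _ (gC c) (gC_exp c) F [] ?_ f3 (by simp) (by simp) (by simp) le_rfl (by simpa using f1)
    (by simpa using f4)
  intro J hJ
  obtain ⟨e1, e2⟩ := f2 J hJ
  refine ⟨e1, fun z hz1 hz2 => ⟨?_, ?_⟩⟩
  · have : ¬ (J.1 < c ∧ c < J.2) := by
      rintro ⟨h1, h2⟩
      exact hcut ⟨e2 _ (by omega) (by omega), e2 _ (by omega) (by omega)⟩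
    unfold gC; split_ifs <;> omega
  · obtain ⟨w, e⟩ := e2 z hz1 hz2
    exact ⟨.inl w, by simp only [extf, e, m3_dec a c hc]⟩

theorem ext_new {X : Type} {Λ a N c : ℕ} (ι : X ≃ Fin N) {f : X ⊕ X → X ⊕ X → Lab} (j : Fin 4)
    {p m : ℕ} {l : ℤ} (hm : 2 ≤ m) (hp : 2 * p ≤ N) (hl : l ≤ 2 * N) :
    ∃ G, IvFam p m l (LS (a + 6) (extf Λ N c ι f) (.inr j)) G := by
  set s : ℕ := Λ + shf j * N with hs
  have key : ∀ b : Bool, ∀ k < N, ∃ w, extf Λ N c ι f (.inr j) w = if b then .hi (s + k) else .lo (s + k) := by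
    intro b k hk
    cases hb : xor b (flg j)
    · refine ⟨.inl (.inl (ι.symm ⟨k, hk⟩)), ?_⟩
      simp only [extf, Equiv.apply_symm_apply, el, ← hs]
      revert hb
      cases b <;> cases flg j <;> simp
    · refine ⟨.inl (.inr (ι.symm ⟨k, hk⟩)), ?_⟩
      simp only [extf, Equiv.apply_symm_apply, el, ← hs]
      revert hb
      cases b <;> cases flg j <;> simp
  refine ⟨[(-(s : ℤ) - N, -(s : ℤ)), ((a + 6 : ℕ) + (s : ℤ), (a + 6 : ℕ) + (s : ℤ) + N)], by simpa using hm, ?_, ?_, ?_⟩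
  · intro I hI
    simp only [List.mem_cons, List.not_mem_nil, or_false] at hI
    rcases hI with rfl | rfl
    · refine ⟨by simp only; omega, fun z hz1 hz2 => ?_⟩
      simp only at hz1 hz2
      obtain ⟨w, e⟩ := key false (-1 - z - s).toNat (by omega)
      refine ⟨w, ?_⟩
      rw [e, if_neg (by simp), ← dec_lo (a + 6)]
      congr 1; omega
    · refine ⟨by simp only; omega, fun z hz1 hz2 => ?_⟩
      simp only at hz1 hz2
      obtain ⟨w, e⟩ := key true (z - (a + 6 : ℕ) - s).toNat (by omega)
      refine ⟨w, ?_⟩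
      rw [e, if_pos rfl, ← dec_hi (a + 6)]
      congr 1; omega
  · simp; omega
  · simp; omega

theorem inc_eq (n : ℕ) (v : Fin n) :
    Swap.incEdges n v = (Finset.univ.erase v).image (fun w => s(v, w)) := by
  classical
  ext e
  simp only [Swap.incEdges, Finset.mem_filter, Finset.mem_univ, true_and, Finset.mem_image, Finset.mem_erase, and_true]
  constructor
  · rintro ⟨h1, h2⟩
    obtain ⟨w, rfl⟩ := Sym2.mem_iff_exists.1 h1
    refine ⟨w, ?_, rfl⟩
    rintro rfl; exact h2 (by simp)
  · rintro ⟨w, h, rfl⟩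
    exact ⟨Sym2.mem_mk_left _ _, by simpa using Ne.symm h⟩

theorem inc_sum {M : Type} [AddCommMonoid M] (n : ℕ) (v : Fin n) (g : Sym2 (Fin n) → M) :
    ∑ e ∈ Swap.incEdges n v, g e = ∑ w ∈ Finset.univ.erase v, g s(v, w) := by
  classical
  rw [inc_eq, Finset.sum_image]
  intro x _ y _ h
  exact Sym2.congr_right.1 h

theorem mem_inc {n : ℕ} {v : Fin n} {e : Sym2 (Fin n)} : e ∈ Swap.incEdges n v ↔ v ∈ e ∧ ¬ e.IsDiag := by
  simp [Swap.incEdges]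

theorem card_nondiag (n : ℕ) [DecidablePred fun e : Sym2 (Fin n) => ¬ e.IsDiag] :
    (Finset.univ.filter fun e : Sym2 (Fin n) => ¬ e.IsDiag).card = Swap.eps n := by
  have := Sym2.card_subtype_not_diag (α := Fin n)
  rw [Fintype.card_fin, Nat.choose_two_right, Fintype.card_subtype] at this
  rw [Swap.eps, ← this]

theorem two_eps (n : ℕ) : n * (n - 1) = 2 * Swap.eps n := by
  unfold Swap.eps
  have := Nat.even_mul_pred_self n
  rw [Nat.mul_div_cancel' this.two_dvd]

/-- numerical value of a label -/
def val (Λ a : ℕ) : Lab → ℕ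
  | .no => 0
  | .lo d => Λ - d
  | .mid j => Λ + 1 + j
  | .hi d => Λ + 1 + a + d

def InR (Λ a : ℕ) : Lab → Prop
  | .no => False
  | .lo d => d < Λ
  | .mid j => j < a
  | .hi d => d < Λ

theorem inR_dec {Λ a : ℕ} {z : ℤ} (h1 : -(Λ : ℤ) ≤ z) (h2 : z < a + Λ) : InR Λ a (dec a z) := by
  unfold dec; split_ifs <;> simp only [InR] <;> omega

theorem inR_dec_iff {Λ a : ℕ} {z : ℤ} (h : InR Λ a (dec a z)) : -(Λ : ℤ) ≤ z ∧ z < a + Λ := by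
  unfold dec at h; split_ifs at h <;> simp only [InR] at h <;> omega

theorem val_dec {Λ a : ℕ} {z : ℤ} (h1 : -(Λ : ℤ) ≤ z) : (val Λ a (dec a z) : ℤ) = z + Λ + 1 := by
  unfold dec; split_ifs <;> simp only [val] <;> omega

theorem val_inj {Λ a : ℕ} {l l' : Lab} (h : InR Λ a l) (h' : InR Λ a l') (e : val Λ a l = val Λ a l') : l = l' := by
  cases l <;> cases l' <;> simp only [InR, val] at h h' e <;> first | (exfalso; omega) | (congr 1; omega)

theorem val_rng {Λ a : ℕ} {l : Lab} (h : InR Λ a l) : 1 ≤ val Λ a l ∧ val Λ a l ≤ 2 * Λ + a := by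
  cases l <;> simp only [InR, val] at h ⊢ <;> omega

def liftF {W : Type} (f : W → W → Lab) (hs : ∀ x y, f x y = f y x) : Sym2 W → Lab := Sym2.lift ⟨f, hs⟩

theorem good_facts {n Λ a : ℕ} {f : Fin n → Fin n → Lab} (hf : Good Λ a f) :
    (∀ x y, x ≠ y → InR Λ a (f x y)) ∧
    Set.InjOn (liftF f hf.symm) {e | ¬ e.IsDiag} := by
  classical
  have hcard : Swap.eps n = 2 * Λ + a := by
    have h1 := hf.card
    have h2 := two_eps n
    rw [Fintype.card_fin] at h1
    omega
  set T := Finset.univ.filter fun e : Sym2 (Fin n) => ¬ e.IsDiag with hT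
  set Z := (Finset.Ico (-(Λ : ℤ)) (a + Λ)).image (dec a) with hZ
  have hZc : Z.card = 2 * Λ + a := by
    rw [hZ, Finset.card_image_of_injective _ (fun x y h => dec_inj a h)]
    simp; omega
  have hsub : Z ⊆ T.image (liftF f hf.symm) := by
    intro l hl
    rw [hZ, Finset.mem_image] at hl
    obtain ⟨z, hz, rfl⟩ := hl
    rw [Finset.mem_Ico] at hz
    obtain ⟨x, y, e⟩ := hf.surj z hz.1 hz.2
    rw [Finset.mem_image]
    refine ⟨s(x, y), ?_, e⟩
    simp only [hT, Finset.mem_filter, Finset.mem_univ, true_and, Sym2.mk_isDiag_iff]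
    rintro rfl
    rw [hf.diag] at e
    exact dec_ne_no _ _ e.symm
  have hTc : T.card = 2 * Λ + a := by rw [hT, card_nondiag, hcard]
  have hle : (T.image (liftF f hf.symm)).card ≤ T.card := Finset.card_image_le
  have heq : Z = T.image (liftF f hf.symm) := Finset.eq_of_subset_of_card_le hsub (by omega)
  constructor
  · intro x y hxy
    have : liftF f hf.symm s(x, y) ∈ Z := by
      rw [heq]; apply Finset.mem_image_of_mem; simp [hT, hxy]
    rw [hZ, Finset.mem_image] at this
    obtain ⟨z, hz, e⟩ := this
    rw [Finset.mem_Ico] at hz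
    have e' : f x y = dec a z := e.symm
    rw [e']; exact inR_dec hz.1 hz.2
  · have := Finset.card_image_iff.1 (show (T.image (liftF f hf.symm)).card = T.card by rw [← heq]; omega)
    simpa [hT] using this

theorem bridge2_good {n Λ a : ℕ} {f : Fin n → Fin n → Lab} (hf : Good Λ a f) :
    Swap.AstrayGood n 3 (fun e => val Λ a (liftF f hf.symm e)) := by
  classical
  obtain ⟨hR, hI⟩ := good_facts hf
  have hcard : Swap.eps n = 2 * Λ + a := by
    have h1 := hf.card
    have h2 := two_eps n
    rw [Fintype.card_fin] at h1
    omega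
  set F := liftF f hf.symm with hF
  have hRF : ∀ e : Sym2 (Fin n), ¬ e.IsDiag → InR Λ a (F e) := by
    intro e
    induction e with | _ x y => 
    intro h; exact hR x y (by simpa using h)
  have hinj : Set.InjOn (fun e => val Λ a (F e)) {e | ¬ e.IsDiag} := by
    intro e he e' he' h
    exact hI he he' (val_inj (hRF e he) (hRF e' he') h)
  have hsurj : ∀ k, 1 ≤ k → k ≤ 2 * Λ + a → ∃ e : Sym2 (Fin n), ¬ e.IsDiag ∧ val Λ a (F e) = k := by
    intro k h1 h2
    obtain ⟨x, y, e⟩ := hf.surj ((k : ℤ) - Λ - 1) (by omega) (by omega)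
    refine ⟨s(x, y), ?_, ?_⟩
    · rw [Sym2.mk_isDiag_iff]
      rintro rfl
      rw [hf.diag] at e
      exact dec_ne_no _ _ e.symm
    · have e' : F s(x, y) = dec a ((k : ℤ) - Λ - 1) := e
      have := val_dec (a := a) (show -(Λ : ℤ) ≤ (k : ℤ) - Λ - 1 by omega)
      rw [e']; omega
  refine ⟨⟨?_, hinj, ?_⟩, ?_⟩
  · intro e he
    rw [hcard]; exact val_rng (hRF e he)
  · intro k hk
    rw [hcard] at hk
    exact hsurj k hk.1 hk.2
  set A := Finset.univ.filter fun e : Sym2 (Fin n) => ¬ e.IsDiag ∧ (Λ + 1 ≤ val Λ a (F e) ∧ val Λ a (F e) ≤ Λ + a) with hA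
  have hAi : A.image (fun e => val Λ a (F e)) = Finset.Icc (Λ + 1) (Λ + a) := by
    ext k
    simp only [hA, Finset.mem_image, Finset.mem_filter, Finset.mem_univ, true_and, Finset.mem_Icc]
    constructor
    · rintro ⟨e, ⟨_, h⟩, rfl⟩; exact h
    · rintro ⟨h1, h2⟩
      obtain ⟨e, he, rfl⟩ := hsurj k (by omega) (by omega)
      exact ⟨e, ⟨he, h1, h2⟩, rfl⟩
  have hAc : A.card = a := by
    have : (A.image (fun e => val Λ a (F e))).card = A.card := by
      apply Finset.card_image_of_injOn
      apply hinj.mono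
      intro e he
      simp [hA] at he
      exact he.1
    rw [← this, hAi]; simp
  have e1 : (Swap.eps n - A.card) / 2 = Λ := by rw [hAc, hcard]; omega
  have e2 : (Swap.eps n + A.card) / 2 = Λ + a := by rw [hAc, hcard]; omega
  refine ⟨A, ?_, by rw [hAc, hcard]; omega, by rw [e1, e2]; exact hAi, ?_⟩
  · intro e he
    simp [hA] at he
    exact he.1
  intro v
  rw [e1, e2, hcard]
  have hmemA : ∀ w, w ≠ v → (s(v, w) ∈ A ↔ (Λ + 1 ≤ val Λ a (f v w) ∧ val Λ a (f v w) ≤ Λ + a)) := by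
    intro w hw
    have : ¬ (s(v, w)).IsDiag := by simpa using hw.symm
    simp only [hA, Finset.mem_filter, Finset.mem_univ, true_and, this, not_false_eq_true]
    rfl
  have hsum : ∀ {M : Type} [AddCommMonoid M] (g : Lab → M), g .no = 0 → 
      ∑ w ∈ Finset.univ.erase v, g (f v w) = ∑ w, g (f v w) := by
    intro M _ g hg
    apply Finset.sum_erase
    rw [hf.diag, hg]
  refine ⟨?_, ?_, ?_⟩
  · refine le_of_eq_of_le ?_ (hf.md v)
    rw [← hsum Lab.md rfl, ← Finset.filter_mem_eq_inter, Finset.card_filter, inc_sum]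
    apply Finset.sum_congr rfl
    intro w hw
    rw [Finset.mem_erase] at hw
    have := hR v w hw.1.symm
    have hm := hmemA w hw.1
    by_cases hh : s(v, w) ∈ A
    · rw [if_pos hh]
      replace hm := hm.1 hh
      cases h : f v w <;> simp only [h, InR, val, Lab.md] at this hm ⊢ <;> omega
    · rw [if_neg hh]
      replace hm := mt hm.2 hh
      cases h : f v w <;> simp only [h, InR, val, Lab.md] at this hm ⊢ <;> omega
  · have h0 := hf.sg v
    rw [← hsum Lab.sg rfl] at h0
    rw [Finset.card_filter, Finset.card_filter, inc_sum, inc_sum]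
    zify
    rw [← sub_eq_zero, ← Finset.sum_sub_distrib, ← neg_eq_zero, ← Finset.sum_neg_distrib]
    refine Eq.trans ?_ h0
    apply Finset.sum_congr rfl
    intro w hw
    rw [Finset.mem_erase] at hw
    have := hR v w hw.1.symm
    have ev : val Λ a (F s(v, w)) = val Λ a (f v w) := rfl
    rw [ev]
    cases h : f v w <;> simp only [h, InR, val, Lab.sg] at this ⊢ <;> split_ifs <;> omega
  · have h0 := hf.sg v
    have h1 := hf.sd v
    rw [← hsum Lab.sg rfl] at h0
    rw [← hsum Lab.sd rfl] at h1
    rw [← Finset.filter_notMem_eq_sdiff, Finset.card_filter, Finset.sum_filter, inc_sum, inc_sum]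
    zify
    rw [← sub_eq_zero, Finset.mul_sum, Finset.sum_mul, ← Finset.sum_sub_distrib]
    have : (0 : ℤ) = 2 * ∑ w ∈ Finset.univ.erase v, (f v w).sd + (a + 1) * ∑ w ∈ Finset.univ.erase v, (f v w).sg := by
      rw [h0, h1]; ring
    refine Eq.trans ?_ this.symm
    rw [Finset.mul_sum, Finset.mul_sum, ← Finset.sum_add_distrib]
    apply Finset.sum_congr rfl
    intro w hw
    rw [Finset.mem_erase] at hw
    have := hR v w hw.1.symm
    have hm := hmemA w hw.1
    have ev : val Λ a (F s(v, w)) = val Λ a (f v w) := rfl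
    rw [ev]
    by_cases hh : s(v, w) ∈ A
    · rw [if_neg (not_not.2 hh), if_neg (not_not.2 hh)]
      replace hm := hm.1 hh
      cases h : f v w <;> simp only [h, InR, val, Lab.sg, Lab.sd] at this hm ⊢ <;> omega
    · rw [if_pos hh, if_pos hh]
      replace hm := mt hm.2 hh
      cases h : f v w <;> simp only [h, InR, val, Lab.sg, Lab.sd] at this hm ⊢ <;> omega

theorem bridge2_type {n Λ a : ℕ} {f : Fin n → Fin n → Lab} (hf : Good Λ a f) {p m ℓ : ℕ} (hp : 0 < p)
    (h : ∀ v, ∃ G, IvFam p m ℓ (LS a f v) G) :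
    Swap.LabelingHasType n p m ℓ (fun e => val Λ a (liftF f hf.symm e)) := by
  classical
  obtain ⟨hR, hI⟩ := good_facts hf
  intro v
  obtain ⟨G, g1, g2, g3, g4⟩ := h v
  have hrng : ∀ z ∈ LS a f v, -(Λ : ℤ) ≤ z ∧ z < a + Λ ∧
      (z + Λ + 1).toNat ∈ Swap.labelSet n (fun e => val Λ a (liftF f hf.symm e)) v := by
    rintro z ⟨w, e⟩
    have hvw : v ≠ w := by
      rintro rfl; rw [hf.diag] at e; exact dec_ne_no _ _ e.symm
    have := hR v w hvw
    rw [e] at this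
    obtain ⟨h1, h2⟩ := inR_dec_iff this
    refine ⟨h1, h2, ?_⟩
    rw [Swap.labelSet, Finset.mem_image]
    refine ⟨s(v, w), mem_inc.2 ⟨Sym2.mem_mk_left _ _, by simpa using hvw⟩, ?_⟩
    have e' : liftF f hf.symm s(v, w) = dec a z := e
    have := val_dec (a := a) h1
    simp only [e']; omega
  set ψ : ℤ × ℤ → Finset ℕ := fun I => Finset.Icc (I.1 + Λ + 1).toNat (I.2 + Λ).toNat with hψ
  have hlow : ∀ I ∈ G, -(Λ : ℤ) ≤ I.1 := fun I hI =>
    (hrng _ ((g2 I hI).2 I.1 le_rfl (by have := (g2 I hI).1; omega))).1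
  have hcardψ : ∀ I ∈ G, ((ψ I).card : ℤ) = I.2 - I.1 := by
    intro I hI
    have := hlow I hI
    have := (g2 I hI).1
    simp only [hψ, Nat.card_Icc]; omega
  have hdisj : G.Pairwise (fun I J => Disjoint (ψ I) (ψ J)) := by
    refine g3.imp_of_mem ?_
    intro I J hI hJ h
    rw [Finset.disjoint_left]
    intro x hx hx'
    have := hlow I hI
    have := hlow J hJ
    simp only [hψ, Finset.mem_Icc] at hx hx'
    omega
  have hne : ∀ I ∈ G, (ψ I).Nonempty := by
    intro I hI
    have := hcardψ I hI
    have := (g2 I hI).1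
    rw [← Finset.card_pos]; omega
  have hdm : (G.map ψ).Pairwise Disjoint := by rw [List.pairwise_map]; exact hdisj
  have hnd : (G.map ψ).Nodup := by
    rw [List.Nodup, List.pairwise_map]
    refine hdisj.imp_of_mem ?_
    intro I J hI hJ h e
    rw [e, disjoint_self] at h
    exact (hne J hJ).ne_empty h
  refine ⟨(G.map ψ).toFinset, ?_, ?_, ?_, ?_⟩
  · rw [List.toFinset_card_of_nodup hnd]; simpa using g1
  · intro K hK
    rw [List.mem_toFinset, List.mem_map] at hK
    obtain ⟨I, hI, rfl⟩ := hK
    have h0 := hlow I hI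
    have h1 := (g2 I hI).1
    refine ⟨⟨_, _, ?_, rfl⟩, ?_, ?_⟩
    · omega
    · intro x hx
      simp only [hψ, Finset.mem_Icc] at hx
      have := (hrng _ ((g2 I hI).2 ((x : ℤ) - Λ - 1) (by omega) (by omega))).2.2
      convert this using 1
      omega
    · have := hcardψ I hI; omega
  · intro K hK L hL hKL
    simp only [List.coe_toFinset, Set.mem_ofPred_eq] at hK hL
    have : ∀ K ∈ G.map ψ, ∀ L ∈ G.map ψ, K ≠ L → Disjoint K L := by
      intro K hK L hL hKL
      rw [List.mem_map] at hK hL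
      obtain ⟨I, hI, rfl⟩ := hK
      obtain ⟨J, hJ, rfl⟩ := hL
      obtain ⟨i, hi, rfl⟩ := List.mem_iff_getElem.1 hI
      obtain ⟨j, hj, rfl⟩ := List.mem_iff_getElem.1 hJ
      rcases lt_trichotomy i j with h | h | h
      · exact List.pairwise_iff_getElem.1 hdisj i j hi hj h
      · subst h; exact absurd rfl hKL
      · exact (List.pairwise_iff_getElem.1 hdisj j i hj hi h).symm
    exact this K hK L hL hKL
  · rw [List.sum_toFinset _ hnd, List.map_map]
    have : (((G.map (Finset.card ∘ ψ)).sum : ℕ) : ℤ) = (G.map fun I => I.2 - I.1).sum := by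
      rw [Nat.cast_list_sum, List.map_map]
      congr 1
      apply List.map_congr_left
      intro I hI
      exact hcardψ I hI
    have h5 : (ℓ : ℤ) ≤ ((G.map (Finset.card ∘ ψ)).sum : ℕ) := by rw [this]; exact g4
    exact Int.ofNat_le.1 h5

/-- the abstract labelling of a numerical one -/
noncomputable def absF {n : ℕ} (Λ a : ℕ) (t : Sym2 (Fin n) → ℕ) (x y : Fin n) : Lab :=
  if x = y then .no else dec a ((t s(x, y) : ℤ) - Λ - 1)

theorem sg_dec (a : ℕ) (z : ℤ) : (dec a z).sg = (if (a : ℤ) ≤ z then 1 else 0) - (if z < 0 then 1 else 0) := by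
  unfold dec; split_ifs <;> simp only [Lab.sg] <;> omega

theorem sd_dec (a : ℕ) (z : ℤ) : 2 * (dec a z).sd =
    (if 0 ≤ z ∧ z < a then 0 else 2 * z - (a - 1)) - (a + 1) * (dec a z).sg := by
  unfold dec; split_ifs <;> simp only [Lab.sg, Lab.sd] <;> omega

theorem md_dec (a : ℕ) (z : ℤ) : (dec a z).md = if 0 ≤ z ∧ z < a then 1 else 0 := by
  unfold dec; split_ifs <;> simp only [Lab.md] <;> omega

theorem bridge1_good {n : ℕ} {t : Sym2 (Fin n) → ℕ} (ht : Swap.AstrayGood n 3 t) :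
    ∃ Λ a, Swap.eps n = 2 * Λ + a ∧ GoodIn Λ a (absF Λ a t) := by
  classical
  obtain ⟨⟨hmaps, hinj, hsurj⟩, A, hAd, hpar, hAi, hv⟩ := ht
  have hmaps' : ∀ e : Sym2 (Fin n), ¬ e.IsDiag → 1 ≤ t e ∧ t e ≤ Swap.eps n := fun e he => hmaps he
  have hAle : A.card ≤ Swap.eps n := by
    rw [← card_nondiag]
    apply Finset.card_le_card
    intro e he
    simpa using hAd e he
  obtain ⟨Λ, hΛ⟩ : ∃ Λ, Swap.eps n = 2 * Λ + A.card := ⟨(Swap.eps n - A.card) / 2, by omega⟩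
  set a := A.card with ha
  have e1 : (Swap.eps n - a) / 2 = Λ := by omega
  have e2 : (Swap.eps n + a) / 2 = Λ + a := by omega
  rw [e1, e2] at hAi
  simp only [e1, e2] at hv
  have hmA : ∀ e : Sym2 (Fin n), ¬ e.IsDiag → (e ∈ A ↔ Λ + 1 ≤ t e ∧ t e ≤ Λ + a) := by
    intro e he
    constructor
    · intro h
      have : t e ∈ A.image t := Finset.mem_image_of_mem _ h
      rw [hAi, Finset.mem_Icc] at this; exact this
    · intro h
      rw [← Finset.mem_Icc, ← hAi, Finset.mem_image] at h
      obtain ⟨e', h1, h2⟩ := h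
      have := hinj (hAd e' h1) he h2
      rwa [← this]
  have hoff : ∀ x y, x ≠ y → absF Λ a t x y = dec a ((t s(x, y) : ℤ) - Λ - 1) := by
    intro x y h; rw [absF, if_neg h]
  have hdiag : ∀ x, absF Λ a t x x = .no := by intro x; simp [absF]
  have hsum : ∀ {M : Type} [AddCommMonoid M] (g : Lab → M) (v : Fin n), g .no = 0 → 
      ∑ w, g (absF Λ a t v w) = ∑ e ∈ Swap.incEdges n v, g (dec a ((t e : ℤ) - Λ - 1)) := by
    intro M _ g v hg
    rw [inc_sum]
    have hz : g (absF Λ a t v v) = 0 := by rw [hdiag, hg]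
    rw [← Finset.sum_erase (f := fun w => g (absF Λ a t v w)) Finset.univ hz]
    apply Finset.sum_congr rfl
    intro w hw
    rw [Finset.mem_erase] at hw
    rw [hoff v w hw.1.symm]
  have hsg : ∀ v, ∑ e ∈ Swap.incEdges n v, (dec a ((t e : ℤ) - Λ - 1)).sg = 0 := by
    intro v
    have := (hv v).2.1
    rw [Finset.card_filter, Finset.card_filter] at this
    zify at this
    rw [eq_comm, ← sub_eq_zero, ← Finset.sum_sub_distrib] at this
    refine Eq.trans ?_ this
    apply Finset.sum_congr rfl
    intro e he
    rw [sg_dec]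
    congr 1
    · congr 1; apply propext; constructor <;> intro h <;> omega
    · congr 1; apply propext; constructor <;> intro h <;> omega
  refine ⟨Λ, a, hΛ, ⟨⟨?_, hdiag, ?_, ?_, ?_, ?_, ?_⟩, ?_, ?_, ?_⟩⟩
  · intro x y
    by_cases h : x = y
    · subst h; rfl
    · rw [hoff _ _ h, hoff _ _ (Ne.symm h), Sym2.eq_swap]
  · intro v
    rw [hsum Lab.sg v rfl]; exact hsg v
  · intro v
    rw [hsum Lab.sd v rfl]
    have h3 := (hv v).2.2
    rw [← Finset.filter_notMem_eq_sdiff, Finset.card_filter, Finset.sum_filter] at h3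
    zify at h3
    rw [← sub_eq_zero, Finset.mul_sum, Finset.sum_mul, ← Finset.sum_sub_distrib] at h3
    have h0 := hsg v
    have key : ∑ e ∈ Swap.incEdges n v, 2 * (dec a ((t e : ℤ) - Λ - 1)).sd = 
       0 - (a + 1) * ∑ e ∈ Swap.incEdges n v, (dec a ((t e : ℤ) - Λ - 1)).sg := by
      refine Eq.trans ?_ (congrArg (· - (a + 1) * ∑ e ∈ Swap.incEdges n v, (dec a ((t e : ℤ) - Λ - 1)).sg) h3)
      rw [Finset.mul_sum, ← Finset.sum_sub_distrib]
      apply Finset.sum_congr rfl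
      intro e he
      rw [sd_dec]
      congr 1
      have hm := hmA e (mem_inc.1 he).2
      by_cases hh : e ∈ A
      · rw [if_neg (not_not.2 hh), if_neg (not_not.2 hh)]
        replace hm := hm.1 hh
        rw [if_pos (by omega)]; omega
      · rw [if_pos hh, if_pos hh]
        replace hm := mt hm.2 hh
        rw [if_neg (by omega)]; omega
    rw [h0, ← Finset.mul_sum] at key
    linarith
  · intro v
    rw [hsum Lab.md v rfl]
    refine le_of_eq_of_le ?_ (hv v).1
    rw [← Finset.filter_mem_eq_inter, Finset.card_filter]
    apply Finset.sum_congr rfl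
    intro e he
    rw [md_dec]
    have hm := hmA e (mem_inc.1 he).2
    congr 1; apply propext; rw [hm]; constructor <;> intro h <;> omega
  · intro z h1 h2
    obtain ⟨e, he, hte⟩ := hsurj (show (z + Λ + 1).toNat ∈ Set.Icc 1 (Swap.eps n) from ⟨by omega, by omega⟩)
    induction e with | _ x y =>
    have hxy : x ≠ y := by simpa using he
    refine ⟨x, y, ?_⟩
    rw [hoff x y hxy, hte]
    congr 1; omega
  · rw [Fintype.card_fin, two_eps, hΛ]
  · intro x y h
    rw [hoff _ _ h]; exact dec_ne_no _ _
  · intro x y x' y' h e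
    have hxy : x ≠ y := by rintro rfl; exact h (hdiag x)
    have hxy' : x' ≠ y' := by rintro rfl; rw [e] at h; exact h (hdiag x')
    rw [hoff _ _ hxy, hoff _ _ hxy'] at e
    have := dec_inj _ e
    exact hinj (show ¬ _ by simpa using hxy) (show ¬ _ by simpa using hxy') (by omega)
  · rintro v z ⟨w, e⟩
    have hvw : v ≠ w := by
      rintro rfl; rw [hdiag] at e; exact dec_ne_no _ _ e.symm
    rw [hoff _ _ hvw] at e
    have := dec_inj _ e
    have := hmaps' s(v, w) (by simpa using hvw)
    omega

theorem bridge1_type {n Λ a : ℕ} {t : Sym2 (Fin n) → ℕ} {p m ℓ : ℕ} 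
    (h : Swap.LabelingHasType n p m ℓ t) :
    ∀ v, ∃ G, IvFam p m ℓ (LS a (absF Λ a t) v) G := by
  classical
  intro v
  obtain ⟨𝒜, h1, h2, h3, h4⟩ := h v
  have hex : ∀ I ∈ 𝒜, ∃ b : ℕ × ℕ, b.1 ≤ b.2 ∧ I = Finset.Icc b.1 b.2 := by
    intro I hI
    obtain ⟨x, y, hxy, e⟩ := (h2 I hI).1
    exact ⟨(x, y), hxy, e⟩
  choose! B hB1 hB2 using hex
  set ψ : Finset ℕ → ℤ × ℤ := fun I => (((B I).1 : ℤ) - Λ - 1, ((B I).2 : ℤ) - Λ) with hψ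
  have hc : ∀ I ∈ 𝒜, (I.card : ℤ) = (ψ I).2 - (ψ I).1 := by
    intro I hI
    have := hB1 I hI
    have e := congrArg Finset.card (hB2 I hI)
    rw [Nat.card_Icc] at e
    simp only [hψ]; omega
  refine ⟨𝒜.toList.map ψ, ?_, ?_, ?_, ?_⟩
  · simpa using h1
  · intro J hJ
    rw [List.mem_map] at hJ
    obtain ⟨I, hI, rfl⟩ := hJ
    rw [Finset.mem_toList] at hI
    obtain ⟨_, hs, hcd⟩ := h2 I hI
    refine ⟨by have := hc I hI; omega, ?_⟩
    intro z hz1 hz2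
    simp only [hψ] at hz1 hz2
    have hm : (z + Λ + 1).toNat ∈ I := by
      rw [hB2 I hI, Finset.mem_Icc]; omega
    have := hs hm
    rw [Swap.labelSet, Finset.mem_image] at this
    obtain ⟨e, he, hte⟩ := this
    rw [inc_eq, Finset.mem_image] at he
    obtain ⟨w, hw, rfl⟩ := he
    rw [Finset.mem_erase] at hw
    refine ⟨w, ?_⟩
    rw [absF, if_neg hw.1.symm, hte]
    congr 1; omega
  · rw [List.pairwise_map]
    have : 𝒜.toList.Pairwise (fun I J => I ≠ J) := 𝒜.nodup_toList
    refine this.imp_of_mem ?_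
    intro I J hI hJ hne
    rw [Finset.mem_toList] at hI hJ
    have hd : Disjoint I J := h3 hI hJ hne
    have b1 := hB1 I hI
    have b2 := hB1 J hJ
    by_contra hcon
    simp only [hψ] at hcon
    rw [Finset.disjoint_left] at hd
    have c1 : ∀ x, x ∈ I ↔ (B I).1 ≤ x ∧ x ≤ (B I).2 := fun x => by
      conv_lhs => rw [hB2 I hI]
      rw [Finset.mem_Icc]
    have c2 : ∀ x, x ∈ J ↔ (B J).1 ≤ x ∧ x ≤ (B J).2 := fun x => by
      conv_lhs => rw [hB2 J hJ]
      rw [Finset.mem_Icc]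
    refine hd (a := max (B I).1 (B J).1) ?_ ?_
    · rw [c1]; omega
    · rw [c2]; omega
  · rw [List.map_map]
    have : (𝒜.toList.map ((fun I : ℤ × ℤ => I.2 - I.1) ∘ ψ)).sum = ((∑ I ∈ 𝒜, I.card : ℕ) : ℤ) := by
      rw [← Finset.sum_map_toList, Nat.cast_list_sum, List.map_map]
      congr 1
      apply List.map_congr_left
      intro I hI
      exact (hc I (Finset.mem_toList.1 hI)).symm
    rw [this]; exact_mod_cast h4

theorem type_le {n : ℕ} {t : Sym2 (Fin n) → ℕ} {p m ℓ : ℕ}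
    (h : Swap.LabelingHasType n p m ℓ t) (v : Fin n) : ℓ ≤ n := by
  classical
  obtain ⟨𝒜, h1, h2, h3, h4⟩ := h v
  have e : (𝒜.biUnion id).card = ∑ I ∈ 𝒜, I.card := Finset.card_biUnion h3
  have hsub : 𝒜.biUnion id ⊆ Swap.labelSet n t v := by
    rw [Finset.biUnion_subset]
    intro I hI; exact (h2 I hI).2.1
  have h5 := Finset.card_le_card hsub
  have h6 : (Swap.labelSet n t v).card ≤ n := by
    refine Finset.card_image_le.trans ?_
    rw [inc_eq]
    refine Finset.card_image_le.trans ?_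
    refine (Finset.card_le_univ _).trans ?_
    simp
  omega

/-- The abstract conclusion: a doubled labelling with good interval families at all vertices. -/
def Concl (p q m : ℕ) (l : ℤ) (Λ a : ℕ) : Prop :=
  ∃ (c : ℕ) (h : Al q → Al q → Bool) (y : Al q → Al q → ℕ) (f1 f2 : Al q → Al q → Lab),
    1 ≤ c ∧ c ≤ a ∧ Good Λ a f1 ∧ Good Λ a f2 ∧ BipGood q h y ∧
    ∀ v, ∃ G, IvFam p (m + 2) (l + 2 * q) (LS (2 * a) (asm a c (Λ + 8 * q * q) f1 f2 h y) v) G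

section runs
variable {q a c D : ℕ} {f1 f2 : Al q → Al q → Lab} {h : Al q → Al q → Bool} {y : Al q → Al q → ℕ}

theorem rowF {r : Al q} {s e : ℕ} (hr : RowHas q h y r false s e) (he : e ≤ D) :
    Sub ((s : ℤ) - D) ((e : ℤ) - D) (LS (2 * a) (asm a c D f1 f2 h y) (.inr r)) := by
  intro z h1 h2
  have := asm_LSr (a := a) (c := c) (f1 := f1) (f2 := f2) (D := D) (b := false) (k := (z + D).toNat) (by omega)
    (hr _ (by omega) (by omega))
  convert this using 1
  simp only [bz]; rw [if_neg (by simp)]; omega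

theorem rowT {r : Al q} {s e : ℕ} (hr : RowHas q h y r true s e) (he : e ≤ D) :
    Sub (2 * (a : ℤ) + D - (e : ℤ)) (2 * (a : ℤ) + D - s) (LS (2 * a) (asm a c D f1 f2 h y) (.inr r)) := by
  intro z h1 h2
  have := asm_LSr (a := a) (c := c) (f1 := f1) (f2 := f2) (D := D) (b := true) (k := (2 * a + D - 1 - z).toNat) (by omega)
    (hr _ (by omega) (by omega))
  convert this using 1
  simp only [bz]; rw [if_pos trivial]; omega

theorem colF {r : Al q} {s e : ℕ} (hr : ColHas q h y r false s e) (he : e ≤ D) :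
    Sub ((s : ℤ) - D) ((e : ℤ) - D) (LS (2 * a) (asm a c D f1 f2 h y) (.inl r)) := by
  intro z h1 h2
  have := asm_LSc (a := a) (c := c) (f1 := f1) (f2 := f2) (D := D) (b := false) (k := (z + D).toNat) (by omega)
    (hr _ (by omega) (by omega))
  convert this using 1
  simp only [bz]; rw [if_neg (by simp)]; omega

theorem colT {r : Al q} {s e : ℕ} (hr : ColHas q h y r true s e) (he : e ≤ D) :
    Sub (2 * (a : ℤ) + D - (e : ℤ)) (2 * (a : ℤ) + D - s) (LS (2 * a) (asm a c D f1 f2 h y) (.inl r)) := by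
  intro z h1 h2
  have := asm_LSc (a := a) (c := c) (f1 := f1) (f2 := f2) (D := D) (b := true) (k := (2 * a + D - 1 - z).toNat) (by omega)
    (hr _ (by omega) (by omega))
  convert this using 1
  simp only [bz]; rw [if_pos trivial]; omega

end runs

section facts
variable {n Λ a : ℕ} {f : Fin n → Fin n → Lab}

theorem uniq (hf : GoodIn Λ a f) {x x' : Fin n} {z z' : ℤ} (hz : z ≠ z') (h1 : z ∈ LS a f x) (h2 : z' ∈ LS a f x)
    (h3 : z ∈ LS a f x') (h4 : z' ∈ LS a f x') : x = x' := by
  obtain ⟨w1, e1⟩ := h1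
  obtain ⟨w2, e2⟩ := h2
  obtain ⟨w3, e3⟩ := h3
  obtain ⟨w4, e4⟩ := h4
  by_contra hne
  have a1 := hf.inj x w1 x' w3 (by rw [e1]; exact dec_ne_no _ _) (by rw [e1, e3])
  have a2 := hf.inj x w2 x' w4 (by rw [e2]; exact dec_ne_no _ _) (by rw [e2, e4])
  rw [Sym2.eq_iff] at a1 a2
  have b1 : w1 = x' := by tauto
  have b2 : w2 = x' := by tauto
  rw [b1] at e1
  rw [b2, e1] at e2
  exact hz (dec_inj _ e2)

theorem mid3 (hf : GoodIn Λ a f) {x : Fin n} (T : Finset ℤ) (hT : ∀ z ∈ T, 0 ≤ z ∧ z < a ∧ z ∈ LS a f x) :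
    T.card ≤ 3 := by
  classical
  have : ∀ z ∈ T, ∃ w, f x w = dec a z := fun z hz => (hT z hz).2.2
  have hnonempty : Nonempty (Fin n) := ⟨x⟩
  choose! w hw using this
  have hin : Set.InjOn w T := by
    intro z hz z' hz' e
    have h1 := hw z hz
    have h2 := hw z' hz'
    rw [e, h2] at h1
    exact (dec_inj _ h1).symm
  refine le_trans ?_ (hf.md x)
  calc T.card = ∑ z ∈ T, (f x (w z)).md := by
        rw [Finset.card_eq_sum_ones]
        apply Finset.sum_congr rfl
        intro z hz
        rw [hw z hz, md_dec, if_pos ⟨(hT z hz).1, (hT z hz).2.1⟩]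
    _ = ∑ v ∈ T.image w, (f x v).md := by rw [Finset.sum_image hin]
    _ ≤ ∑ v, (f x v).md := Finset.sum_le_sum_of_subset (Finset.subset_univ _)

theorem mid_ge (hf : GoodIn Λ a f) (hn : n % 2 = 0) : n ≤ 2 * a := by
  classical
  obtain ⟨hR, -⟩ := good_facts hf.toGood
  have h1 : ∀ x, 1 ≤ ∑ w, (f x w).md := by
    intro x
    have key : ∀ w ∈ Finset.univ.erase x, ∃ k : ℤ, ((f x w).md : ℤ) = 1 + (f x w).sg + 2 * k := by
      intro w hw
      have := hf.offd x w (Finset.ne_of_mem_erase hw).symm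
      cases h : f x w
      · exact absurd h this
      · exact ⟨0, by simp [Lab.md, Lab.sg]⟩
      · exact ⟨0, by simp [Lab.md, Lab.sg]⟩
      · exact ⟨-1, by simp [Lab.md, Lab.sg]⟩
    choose! k hk using key
    have e1 : ∑ w, (f x w).md = ∑ w ∈ Finset.univ.erase x, (f x w).md := by
      symm; apply Finset.sum_erase; rw [hf.diag]; rfl
    have e2 : ∑ w ∈ Finset.univ.erase x, (f x w).sg = 0 := by
      rw [← hf.sg x]; apply Finset.sum_erase; rw [hf.diag]; rfl
    have e3 : ((∑ w ∈ Finset.univ.erase x, (f x w).md : ℕ) : ℤ) = ((n - 1 : ℕ) : ℤ) + 0 + 2 * ∑ w ∈ Finset.univ.erase x, k w := by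
      push_cast
      rw [Finset.sum_congr rfl hk, Finset.sum_add_distrib, Finset.sum_add_distrib, e2, ← Finset.mul_sum]
      simp
    have := x.pos
    rw [e1]
    omega
  have h2 : n ≤ ∑ x, ∑ w, (f x w).md := by
    calc n = ∑ x : Fin n, 1 := by simp
      _ ≤ _ := Finset.sum_le_sum fun x _ => h1 x
  refine h2.trans ?_
  rw [← Finset.sum_product' (f := fun x w => (f x w).md)]
  set P := (Finset.univ ×ˢ Finset.univ : Finset (Fin n × Fin n)).filter fun e => (f e.1 e.2).md = 1 with hP
  have h3 : ∑ e ∈ (Finset.univ ×ˢ Finset.univ : Finset (Fin n × Fin n)), (f e.1 e.2).md = P.card := by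
    rw [hP, Finset.card_filter]
    apply Finset.sum_congr rfl
    intro e _
    cases f e.1 e.2 <;> simp [Lab.md]
  rw [h3]
  set pos : Lab → ℕ := fun l => match l with | .mid j => j | _ => 0 with hpos
  have h4 := Finset.card_le_mul_card_image_of_maps_to (s := P) (t := Finset.range a) (f := fun e => pos (f e.1 e.2)) ?_ 2 ?_
  · simpa using h4
  · intro e he
    simp only [hP, Finset.mem_filter] at he
    have hne : e.1 ≠ e.2 := by
      intro h
      have := he.2
      rw [h, hf.diag] at this
      simp [Lab.md] at this
    have := hR e.1 e.2 hne
    simp only [hpos]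
    cases h : f e.1 e.2 <;> rw [h] at he this <;> simp [Lab.md, InR] at he this ⊢
    exact this
  · intro j hj
    rcases (Finset.filter (fun e => pos (f e.1 e.2) = j) P).eq_empty_or_nonempty with h | ⟨e0, he0⟩
    · rw [h]; simp
    · refine le_trans (Finset.card_le_card (t := {e0, e0.swap}) ?_) Finset.card_le_two
      intro e he
      simp only [hP, Finset.mem_filter] at he he0
      have hm : ∀ e : Fin n × Fin n, (f e.1 e.2).md = 1 → pos (f e.1 e.2) = j → f e.1 e.2 = .mid j := by
        intro e h1 h2
        cases h : f e.1 e.2 <;> rw [h] at h1 h2 <;> simp [Lab.md, hpos] at h1 h2 ⊢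
        exact h2
      have q1 := hm e he.1.2 he.2
      have q2 := hm e0 he0.1.2 he0.2
      have := hf.inj e.1 e.2 e0.1 e0.2 (by rw [q1]; simp) (by rw [q1, q2])
      rw [Sym2.eq_iff] at this
      rw [Finset.mem_insert, Finset.mem_singleton]
      rcases this with h | h
      · left; exact Prod.ext h.1 h.2
      · right; exact Prod.ext h.1 h.2

def rf (a : ℕ) : Lab → Lab
  | .no => .no
  | .lo d => .hi d
  | .mid j => .mid (a - 1 - j)
  | .hi d => .lo d

theorem rf_dec (a : ℕ) (z : ℤ) : rf a (dec a z) = dec a (a - 1 - z) := by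
  unfold dec; split_ifs <;> simp only [rf] <;> first | (exfalso; omega) | (congr 1; omega)

theorem rf_rf {l : Lab} (h : l = .no ∨ InR Λ a l) : rf a (rf a l) = l := by
  cases l <;> simp [InR, rf] at h ⊢
  omega

theorem rf_good (hf : GoodIn Λ a f) : GoodIn Λ a (fun x y => rf a (f x y)) := by
  obtain ⟨hR, -⟩ := good_facts hf.toGood
  have hR' : ∀ x y, f x y = .no ∨ InR Λ a (f x y) := by
    intro x y
    by_cases h : x = y
    · left; rw [h, hf.diag]
    · right; exact hR x y h
  have hsg : ∀ l, (rf a l).sg = -l.sg := by intro l; cases l <;> rfl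
  have hsd : ∀ l, (rf a l).sd = -l.sd := by intro l; cases l <;> simp [rf, Lab.sd]
  have hmd : ∀ l, (rf a l).md = l.md := by intro l; cases l <;> rfl
  have hno : ∀ l, rf a l = .no ↔ l = .no := by intro l; cases l <;> simp [rf]
  refine ⟨⟨?_, ?_, ?_, ?_, ?_, ?_, hf.card⟩, ?_, ?_, ?_⟩
  · intro x y; simp only [hf.symm x y]
  · intro x; simp only [hf.diag]; rfl
  · intro v; simp only [hsg, Finset.sum_neg_distrib, hf.sg v, neg_zero]
  · intro v; simp only [hsd, Finset.sum_neg_distrib, hf.sd v, neg_zero]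
  · intro v; simp only [hmd]; exact hf.md v
  · intro z h1 h2
    obtain ⟨x, y, e⟩ := hf.surj (a - 1 - z) (by omega) (by omega)
    refine ⟨x, y, ?_⟩
    simp only [e, rf_dec]; congr 1; omega
  · intro x y h; rw [Ne, hno]; exact hf.offd x y h
  · intro x y x' y' h e
    rw [Ne, hno] at h
    refine hf.inj x y x' y' h ?_
    have := congrArg (rf a) e
    rwa [rf_rf (hR' x y), rf_rf (hR' x' y')] at this
  · rintro v z ⟨w, e⟩
    have := congrArg (rf a) e
    simp only at this
    rw [rf_rf (hR' v w), rf_dec] at this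
    have := hf.rng v (a - 1 - z) ⟨w, this⟩
    omega

theorem rf_fam {p m : ℕ} {l : ℤ} {v : Fin n} {F : List (ℤ × ℤ)} (hF : IvFam p m l (LS a f v) F) :
    IvFam p m l (LS a (fun x y => rf a (f x y)) v) (F.map fun I => ((a : ℤ) - I.2, (a : ℤ) - I.1)) := by
  obtain ⟨f1, f2, f3, f4⟩ := hF
  refine ⟨by simpa using f1, ?_, ?_, ?_⟩
  · intro J hJ
    rw [List.mem_map] at hJ
    obtain ⟨I, hI, rfl⟩ := hJ
    obtain ⟨g1, g2⟩ := f2 I hI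
    refine ⟨by simp only; omega, fun z h1 h2 => ?_⟩
    simp only at h1 h2
    obtain ⟨w, e⟩ := g2 (a - 1 - z) (by omega) (by omega)
    refine ⟨w, ?_⟩
    simp only [e, rf_dec]; congr 1; omega
  · rw [List.pairwise_map]
    refine f3.imp ?_
    intro I J h
    simp only; omega
  · rw [List.map_map]
    refine f4.trans (le_of_eq ?_)
    congr 1
    apply List.map_congr_left
    intro I _
    simp

end facts

theorem sq8 {q : ℕ} (hq : 2 ≤ q) : 16 * q ≤ 8 * q * q := by nlinarith

section cases
variable {p q m Λ a : ℕ} {l : ℤ} {f : Fin (4 * q) → Fin (4 * q) → Lab} {F : Fin (4 * q) → List (ℤ × ℤ)}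

theorem gen1 (hp : 0 < p) (hq : 2 * p ≤ q) (hf : GoodIn Λ a f) (φ : Al q ≃ Fin (4 * q))
    {f2 : Al q → Al q → Lab} {c : ℕ} (hc : c ≤ a) {h : Al q → Al q → Bool} {y : Al q → Al q → ℕ}
    (hb : BipGood q h y) (x : Al q) {G : List (ℤ × ℤ)} (hG : IvFam p m l (LS a f (φ x)) G)
    (hn : ∀ J ∈ G, ¬ (J.1 < c ∧ c < J.2)) :
    ∃ G, IvFam p (m + 2) (l + 2 * q)
      (LS (2 * a) (asm a c (Λ + 8 * q * q) (fun u v => f (φ u) (φ v)) f2 h y) (.inl x)) G := by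
  obtain ⟨sl, hsl⟩ := hb.colrun x false
  obtain ⟨sh, hsh⟩ := hb.colrun x true
  have el : sl + q ≤ 8 * q * q := by
    obtain ⟨r, _, e⟩ := hsl (sl + q - 1) (by omega) (by omega)
    have := hb.lt r x
    omega
  have eh : sh + q ≤ 8 * q * q := by
    obtain ⟨r, _, e⟩ := hsh (sh + q - 1) (by omega) (by omega)
    have := hb.lt r x
    omega
  refine V1 (Λ := Λ) (a := a) (c := c) (N := 8 * q * q) (D := Λ + 8 * q * q) (sl := sl) (sh := sh) (S := LS a f (φ x)) ?_
    hp hq hG hn hc rfl el eh (colF hsl (by omega)) (colT hsh (by omega))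
  intro z hz
  refine ⟨asm_LS1 hc ?_, hf.rng _ _ hz⟩
  rw [LS_comp φ x]; exact hz

theorem sp1 (hq : 2 ≤ q) (hf : GoodIn Λ a f) (φ : Al q ≃ Fin (4 * q))
    {f2 : Al q → Al q → Lab} {c : ℕ} (hc : c ≤ a) 
    {G : List (ℤ × ℤ)} (hG : IvFam 1 m l (LS a f (φ (false, false, ⟨0, by omega⟩))) G)
    (I : ℤ × ℤ) (hI : I ∈ G) (h1 : I.1 < c) (h2 : I.2 = c + 1) :
    ∃ G, IvFam 1 (m + 2) (l + 2 * q)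
      (LS (2 * a) (asm a c (Λ + 8 * q * q) (fun u v => f (φ u) (φ v)) f2 (bipH q) (bipY q (AR q) (AC q)))
        (.inl (false, false, ⟨0, by omega⟩))) G := by
  have h8 := sq8 hq
  refine V1s (Λ := Λ) (a := a) (c := c) (N := 8 * q * q) (D := Λ + 8 * q * q) (sl := 6 * q) (sh := 6 * q)
    (S := LS a f (φ (false, false, ⟨0, by omega⟩))) ?_
    one_pos (by omega) hG I hI h1 h2 (Or.inr rfl) hc rfl (by omega) (by omega) 
    (colF (e := 6 * q + q + 1) ?_ (by omega)) (colT (e := 6 * q + q + 1) ?_ (by omega))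
  · intro z hz
    refine ⟨asm_LS1 hc ?_, hf.rng _ _ hz⟩
    rw [LS_comp φ _]; exact hz
  · have := bipA_col0 q hq false
    have e : 6 * q + q + 1 = 7 * q + 1 := by ring
    rwa [e]
  · have := bipA_col0 q hq true
    have e : 6 * q + q + 1 = 7 * q + 1 := by ring
    rwa [e]

theorem hS2 {q Λ a c : ℕ} {f : Fin (4 * q) → Fin (4 * q) → Lab} (φ : Al q ≃ Fin (4 * q))
    {f1 : Al q → Al q → Lab} (hc : c ≤ a) {h : Al q → Al q → Bool} {y : Al q → Al q → ℕ} (x : Al q) :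
    ∀ z ∈ LS a f (φ x), gB a c (Λ + 8 * q * q) z ∈
      LS (2 * a) (asm a c (Λ + 8 * q * q) f1 (fun u v => f (φ u) (φ v)) h y) (.inr x) := by
  intro z hz
  refine asm_LS2 hc ?_
  rw [LS_comp φ x]; exact hz

theorem gen2 (hp : 0 < p) (hq : 2 * p ≤ q) (φ : Al q ≃ Fin (4 * q))
    {f1 : Al q → Al q → Lab} {c : ℕ} (hc : c ≤ a) {h : Al q → Al q → Bool} {y : Al q → Al q → ℕ}
    (hb : BipGood q h y) (x : Al q) {G : List (ℤ × ℤ)} (hG : IvFam p m l (LS a f (φ x)) G)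
    (hn : ∀ J ∈ G, ¬ (J.1 < 0 ∧ 0 < J.2) ∧ ¬ (J.1 < a ∧ a < J.2)) :
    ∃ G, IvFam p (m + 2) (l + 2 * q)
      (LS (2 * a) (asm a c (Λ + 8 * q * q) f1 (fun u v => f (φ u) (φ v)) h y) (.inr x)) G := by
  obtain ⟨sl, hsl⟩ := hb.rowrun x false
  obtain ⟨sh, hsh⟩ := hb.rowrun x true
  have el : sl + q ≤ 8 * q * q := by
    obtain ⟨r, _, e⟩ := hsl (sl + q - 1) (by omega) (by omega)
    have := hb.lt x r
    omega
  have eh : sh + q ≤ 8 * q * q := by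
    obtain ⟨r, _, e⟩ := hsh (sh + q - 1) (by omega) (by omega)
    have := hb.lt x r
    omega
  exact V2 (Λ := Λ) (a := a) (c := c) (N := 8 * q * q) (D := Λ + 8 * q * q) (sl := sl) (sh := sh) (hS2 φ hc x)
    hq hG hn hc rfl el eh (rowF hsl (by omega)) (rowT hsh (by omega))

/-- choice of the cut -/
theorem exists_cut (hp : 0 < p) (hq : 2 * p ≤ q) (hf : GoodIn Λ a f)
    (hF : ∀ v, IvFam p m l (LS a f v) (F v)) :
    ∃ (c : ℕ) (v : Fin (4 * q)), 1 ≤ c ∧ c ≤ a ∧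
      ∀ x, ∀ I ∈ F x, I.1 < c → c < I.2 → x = v ∧ I.2 = c + 1 ∧ p = 1 := by
  have ha : 4 * q ≤ 2 * a := mid_ge hf (by omega)
  by_cases hx : ∃ u, ∃ I ∈ F u, I.1 < (a : ℤ) ∧ (a : ℤ) < I.2
  swap
  · refine ⟨a, ⟨0, by omega⟩, by omega, le_rfl, ?_⟩
    intro x I hI h1 h2
    exact absurd ⟨x, I, hI, h1, h2⟩ hx
  obtain ⟨u, I', hI', h1', h2'⟩ := hx
  obtain ⟨g1, g2⟩ := (hF u).2.1 I' hI'
  have hlow : (a : ℤ) - 3 ≤ I'.1 := by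
    by_contra hcon
    have := mid3 hf (x := u) (Finset.Ico ((a : ℤ) - 4) a) (by
      intro z hz
      rw [Finset.mem_Ico] at hz
      exact ⟨by omega, by omega, g2 z (by omega) (by omega)⟩)
    simp at this
  obtain ⟨c, hc⟩ : ∃ c : ℕ, (c : ℤ) = I'.1 := ⟨I'.1.toNat, by omega⟩
  obtain ⟨v, hv⟩ := g2 c (by omega) (by omega)
  refine ⟨c, v, by omega, by omega, ?_⟩
  intro x I hI h1 h2
  obtain ⟨k1, k2⟩ := (hF x).2.1 I hI
  have hxu : x ≠ u := by
    rintro rfl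
    have hpw := (hF x).2.2.1
    obtain ⟨i, hi, ei⟩ := List.mem_iff_getElem.1 hI
    obtain ⟨j, hj, ej⟩ := List.mem_iff_getElem.1 hI'
    rcases lt_trichotomy i j with h | h | h
    · have := List.pairwise_iff_getElem.1 hpw i j hi hj h
      rw [ei, ej] at this; omega
    · subst h; rw [ei] at ej; rw [ej] at h1; omega
    · have := List.pairwise_iff_getElem.1 hpw j i hj hi h
      rw [ei, ej] at this; omega
  have hcx := k2 c h1.le h2
  have hcx' := hcx
  obtain ⟨w, hw⟩ := hcx
  have hs := hf.inj u v x w (by rw [hv]; exact dec_ne_no _ _) (by rw [hv, hw])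
  rw [Sym2.eq_iff] at hs
  have hxv : x = v := by
    rcases hs with h | h
    · exact absurd h.1.symm hxu
    · exact h.2.symm
  have hI2 : I.2 = c + 1 := by
    by_contra hcon
    exact hxu (uniq hf (z := c) (z' := c + 1) (by omega) hcx' (k2 (c + 1) (by omega) (by omega))
      (g2 c (by omega) (by omega)) (g2 (c + 1) (by omega) (by omega)))
  refine ⟨hxv, hI2, ?_⟩
  by_contra hp1
  have := mid3 hf (x := x) (Finset.Ico ((c : ℤ) - 3) (c + 1)) (by
      intro z hz
      rw [Finset.mem_Ico] at hz
      exact ⟨by omega, by omega, k2 z (by omega) (by omega)⟩)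
  simp at this

theorem exists_equiv (hq : 0 < q) (u u' : Fin (4 * q)) (h : u ≠ u') :
    ∃ φ : Al q ≃ Fin (4 * q), φ (false, false, ⟨0, hq⟩) = u ∧ φ (false, true, ⟨0, hq⟩) = u' := by
  classical
  have e : Al q ≃ Fin (4 * q) := Fintype.equivFinOfCardEq (by simp; ring)
  set A : Al q := (false, false, ⟨0, hq⟩) with hA
  set B : Al q := (false, true, ⟨0, hq⟩) with hB
  have hAB : A ≠ B := by simp [hA, hB]
  set φ1 := e.trans (Equiv.swap (e A) u) with h1
  have e1 : φ1 A = u := by simp [h1]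
  have e2 : u ≠ φ1 B := by rw [← e1]; exact fun hh => hAB (φ1.injective hh)
  refine ⟨φ1.trans (Equiv.swap (φ1 B) u'), ?_, ?_⟩
  · rw [Equiv.trans_apply, e1, Equiv.swap_apply_of_ne_of_ne e2 h]
  · rw [Equiv.trans_apply, Equiv.swap_apply_left]

/-- the first copy, with design A -/
theorem copy1A (hp : 0 < p) (hq : 2 * p ≤ q) (hf : GoodIn Λ a f)
    (hF : ∀ v, IvFam p m l (LS a f v) (F v)) :
    ∃ (c : ℕ) (φ : Al q ≃ Fin (4 * q)), 1 ≤ c ∧ c ≤ a ∧ ∀ (f2 : Al q → Al q → Lab) (x : Al q),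
    ∃ G, IvFam p (m + 2) (l + 2 * q)
      (LS (2 * a) (asm a c (Λ + 8 * q * q) (fun u v => f (φ u) (φ v)) f2 (bipH q) (bipY q (AR q) (AC q)))
        (.inl x)) G := by
  obtain ⟨c, v, hc1, hc, hv⟩ := exists_cut hp hq hf hF
  have : Nontrivial (Fin (4 * q)) := Fin.nontrivial_iff_two_le.2 (by omega)
  obtain ⟨v', hv'⟩ := exists_ne v
  have hq0 : 0 < q := by omega
  obtain ⟨φ, e1, e2⟩ := exists_equiv hq0 v v' hv'.symm
  refine ⟨c, φ, hc1, hc, fun f2 x => ?_⟩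
  by_cases hx : ∃ I ∈ F (φ x), I.1 < (c : ℤ) ∧ (c : ℤ) < I.2
  · obtain ⟨I, hI, h1, h2⟩ := hx
    obtain ⟨k1, k2, rfl⟩ := hv _ I hI h1 h2
    have : x = (false, false, ⟨0, hq0⟩) := φ.injective (by rw [k1, e1])
    subst this
    exact sp1 (by omega) hf φ hc (hF _) I hI h1 k2
  · refine gen1 hp hq hf φ hc (bipA_good q (by omega)) x (hF _) ?_
    intro J hJ h
    exact hx ⟨J, hJ, h⟩

theorem cross0_le (hq : 2 ≤ q) (hf : GoodIn Λ a f) (hF : ∀ v, IvFam p m l (LS a f v) (F v)) {u : Fin (4 * q)} {I : ℤ × ℤ}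
    (hI : I ∈ F u) (h1 : I.1 < 0) : I.2 ≤ 3 := by
  have ha : 4 * q ≤ 2 * a := mid_ge hf (by omega)
  by_contra hcon
  have := mid3 hf (x := u) (Finset.Ico 0 4) (by
      intro z hz
      rw [Finset.mem_Ico] at hz
      exact ⟨by omega, by omega, ((hF u).2.1 I hI).2 z (by omega) (by omega)⟩)
  simp at this

theorem crossa_ge (hq : 2 ≤ q) (hf : GoodIn Λ a f) (hF : ∀ v, IvFam p m l (LS a f v) (F v)) {u : Fin (4 * q)} {I : ℤ × ℤ}
    (hI : I ∈ F u) (h1 : (a : ℤ) < I.2) : a - 3 ≤ I.1 := by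
  have ha : 4 * q ≤ 2 * a := mid_ge hf (by omega)
  by_contra hcon
  have := mid3 hf (x := u) (Finset.Ico (a - 4 : ℤ) a) (by
      intro z hz
      rw [Finset.mem_Ico] at hz
      exact ⟨by omega, by omega, ((hF u).2.1 I hI).2 z (by omega) (by omega)⟩)
  simp at this

theorem cross0_uniq (hf : GoodIn Λ a f) (hF : ∀ v, IvFam p m l (LS a f v) (F v)) {u v : Fin (4 * q)} {I J : ℤ × ℤ}
    (hI : I ∈ F u) (hJ : J ∈ F v) {k : ℤ} (h1 : I.1 < k) (h2 : k < I.2) (h3 : J.1 < k) (h4 : k < J.2) : u = v :=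
  uniq hf (z := k - 1) (z' := k) (by omega) (((hF u).2.1 I hI).2 _ (by omega) (by omega))
    (((hF u).2.1 I hI).2 _ (by omega) (by omega)) (((hF v).2.1 J hJ).2 _ (by omega) (by omega))
    (((hF v).2.1 J hJ).2 _ (by omega) (by omega))

theorem caseNot (hp : 0 < p) (hq : 2 * p ≤ q) (hf : GoodIn Λ a f)
    (hF : ∀ v, IvFam p m l (LS a f v) (F v)) 
    (hnb : ∀ u, ∀ I ∈ F u, ∀ I' ∈ F u, I.1 < 0 → 0 < I.2 → I'.1 < (a : ℤ) → (a : ℤ) < I'.2 → False) :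
    Concl p q m l Λ a := by
  have hq0 : 0 < q := by omega
  have h8 := sq8 (show 2 ≤ q by omega)
  obtain ⟨c, φ1, hc1, hc, hcopy1⟩ := copy1A hp hq hf hF
  have : Nontrivial (Fin (4 * q)) := Fin.nontrivial_iff_two_le.2 (by omega)
  obtain ⟨u, u', hne, hu, hu'⟩ : ∃ u u' : Fin (4 * q), u ≠ u' ∧
      (∀ x, ∀ I ∈ F x, I.1 < 0 → 0 < I.2 → x = u) ∧
      (∀ x, ∀ I ∈ F x, I.1 < (a : ℤ) → (a : ℤ) < I.2 → x = u') := by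
    by_cases h0 : ∃ x, ∃ I ∈ F x, I.1 < 0 ∧ 0 < I.2
    · obtain ⟨u, I, hI, i1, i2⟩ := h0
      have hu : ∀ x, ∀ I ∈ F x, I.1 < 0 → 0 < I.2 → x = u := fun x J hJ j1 j2 =>
        cross0_uniq hf hF hJ hI (k := 0) j1 j2 i1 i2
      by_cases ha : ∃ x, ∃ I ∈ F x, I.1 < (a : ℤ) ∧ (a : ℤ) < I.2
      · obtain ⟨u', I', hI', i1', i2'⟩ := ha
        refine ⟨u, u', ?_, hu, fun x J hJ j1 j2 => cross0_uniq hf hF hJ hI' (k := a) j1 j2 i1' i2'⟩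
        rintro rfl
        exact hnb u I hI I' hI' i1 i2 i1' i2'
      · obtain ⟨u', hu'⟩ := exists_ne u
        exact ⟨u, u', hu'.symm, hu, fun x J hJ j1 j2 => absurd ⟨x, J, hJ, j1, j2⟩ ha⟩
    · by_cases ha : ∃ x, ∃ I ∈ F x, I.1 < (a : ℤ) ∧ (a : ℤ) < I.2
      · obtain ⟨u', I', hI', i1', i2'⟩ := ha
        obtain ⟨u, hu⟩ := exists_ne u'
        exact ⟨u, u', hu, fun x J hJ j1 j2 => absurd ⟨x, J, hJ, j1, j2⟩ h0,
          fun x J hJ j1 j2 => cross0_uniq hf hF hJ hI' (k := a) j1 j2 i1' i2'⟩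
      · obtain ⟨u', hu'⟩ := exists_ne (⟨0, by omega⟩ : Fin (4 * q))
        exact ⟨_, u', hu'.symm, fun x J hJ j1 j2 => absurd ⟨x, J, hJ, j1, j2⟩ h0,
          fun x J hJ j1 j2 => absurd ⟨x, J, hJ, j1, j2⟩ ha⟩
  obtain ⟨φ2, e1, e2⟩ := exists_equiv hq0 u u' hne
  refine ⟨c, bipH q, bipY q (AR q) (AC q), fun x y => f (φ1 x) (φ1 y), fun x y => f (φ2 x) (φ2 y), hc1, hc,
    hf.toGood.comp φ1, hf.toGood.comp φ2, bipA_good q (by omega), ?_⟩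
  rintro (x | x)
  · exact hcopy1 _ x
  by_cases h0 : ∃ I ∈ F (φ2 x), I.1 < 0 ∧ 0 < I.2
  · obtain ⟨I, hI, i1, i2⟩ := h0
    have hx : x = (false, false, ⟨0, hq0⟩) := φ2.injective (by rw [e1, hu _ I hI i1 i2])
    subst hx
    obtain ⟨r1, r2⟩ := bipA_row0 q (by omega)
    have hR1 := rowF (a := a) (c := c) (D := Λ + 8 * q * q) (f1 := fun x y => f (φ1 x) (φ1 y))
      (f2 := fun x y => f (φ2 x) (φ2 y)) r1 (by omega)
    have hR2 := rowT (a := a) (c := c) (D := Λ + 8 * q * q) (f1 := fun x y => f (φ1 x) (φ1 y))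
      (f2 := fun x y => f (φ2 x) (φ2 y)) r2 (by omega)
    refine V2lo (Λ := Λ) (a := a) (c := c) (N := 8 * q * q) (D := Λ + 8 * q * q) (hS2 φ2 hc _)
      hq hp (hF _) I hI i1 i2 (cross0_le (by omega) hf hF hI i1) ?_ hc rfl (by omega) (by simpa using hR1) hR2
    intro J hJ hh
    exact hnb _ I hI J hJ i1 i2 hh.1 hh.2
  by_cases ha : ∃ I ∈ F (φ2 x), I.1 < (a : ℤ) ∧ (a : ℤ) < I.2
  · obtain ⟨I, hI, i1, i2⟩ := ha
    have hx : x = (false, true, ⟨0, hq0⟩) := φ2.injective (by rw [e2, hu' _ I hI i1 i2])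
    subst hx
    obtain ⟨r1, r2⟩ := bipA_row1 q (by omega)
    have hR1 := rowT (a := a) (c := c) (D := Λ + 8 * q * q) (f1 := fun x y => f (φ1 x) (φ1 y))
      (f2 := fun x y => f (φ2 x) (φ2 y)) r1 (by omega)
    have hR2 := rowF (a := a) (c := c) (D := Λ + 8 * q * q) (f1 := fun x y => f (φ1 x) (φ1 y))
      (f2 := fun x y => f (φ2 x) (φ2 y)) r2 (by omega)
    refine V2hi (Λ := Λ) (a := a) (c := c) (N := 8 * q * q) (D := Λ + 8 * q * q) (hS2 φ2 hc _)
      hq hp (hF _) I hI i1 i2 (crossa_ge (by omega) hf hF hI i2) ?_ hc rfl (by omega) (by simpa using hR1) hR2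
    intro J hJ hh
    exact h0 ⟨J, hJ, hh⟩
  · refine gen2 hp hq φ2 hc (bipA_good q (by omega)) x (hF _) ?_
    intro J hJ
    exact ⟨fun hh => h0 ⟨J, hJ, hh⟩, fun hh => ha ⟨J, hJ, hh⟩⟩

theorem caseBoth (hp : 0 < p) (hq : 2 * p ≤ q) (hf : GoodIn Λ a f)
    (hF : ∀ v, IvFam p m l (LS a f v) (F v)) (u : Fin (4 * q)) (I I' : ℤ × ℤ) (hI : I ∈ F u) (hI' : I' ∈ F u)
    (hne : I' ≠ I) (i1 : I.1 < 0) (i2 : 0 < I.2) (i3 : I.2 ≤ 2) (j1 : I'.1 = a - 1) (j2 : (a : ℤ) < I'.2) :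
    Concl p q m l Λ a := by
  have hq0 : 0 < q := by omega
  have h8 := sq8 (show 2 ≤ q by omega)
  have : Nontrivial (Fin (4 * q)) := Fin.nontrivial_iff_two_le.2 (by omega)
  obtain ⟨u', hu'⟩ := exists_ne u
  obtain ⟨φ2, e1, e2⟩ := exists_equiv hq0 u u' hu'.symm
  have hgen : ∀ x, x ≠ u → ∀ J ∈ F x, ¬ (J.1 < 0 ∧ 0 < J.2) ∧ ¬ (J.1 < (a : ℤ) ∧ (a : ℤ) < J.2) := by
    intro x hx J hJ
    refine ⟨fun hh => hx ?_, fun hh => hx ?_⟩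
    · exact cross0_uniq hf hF hJ hI (k := 0) hh.1 hh.2 i1 i2
    · exact cross0_uniq hf hF hJ hI' (k := a) hh.1 hh.2 (by omega) j2
  rw [← e1] at hI hI'
  by_cases hp1 : p = 1
  · subst hp1
    obtain ⟨c, φ1, hc1, hc, hcopy1⟩ := copy1A hp hq hf hF
    refine ⟨c, bipH q, bipY q (AR q) (AC q), fun x y => f (φ1 x) (φ1 y), fun x y => f (φ2 x) (φ2 y), hc1, hc,
      hf.toGood.comp φ1, hf.toGood.comp φ2, bipA_good q (by omega), ?_⟩
    rintro (x | x)
    · exact hcopy1 _ x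
    by_cases hx : x = (false, false, ⟨0, hq0⟩)
    · subst hx
      obtain ⟨r1, r2⟩ := bipA_row0 q (by omega)
      have hR1 := rowF (a := a) (c := c) (D := Λ + 8 * q * q) (f1 := fun x y => f (φ1 x) (φ1 y))
        (f2 := fun x y => f (φ2 x) (φ2 y)) r1 (by omega)
      have hR2 := rowT (a := a) (c := c) (D := Λ + 8 * q * q) (f1 := fun x y => f (φ1 x) (φ1 y))
        (f2 := fun x y => f (φ2 x) (φ2 y)) r2 (by omega)
      exact V2both1 (Λ := Λ) (a := a) (c := c) (N := 8 * q * q) (D := Λ + 8 * q * q) (hS2 φ2 hc _)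
        (by omega) (hF _) I I' hI hI' hne i1 i2 i3 j1 j2 hc rfl (by omega) (by simpa using hR1) hR2
    · refine gen2 hp hq φ2 hc (bipA_good q (by omega)) x (hF _) (hgen _ ?_)
      rw [← e1]; exact fun hh => hx (φ2.injective hh)
  · obtain ⟨c, v, hc1, hc, hv⟩ := exists_cut hp hq hf hF
    refine ⟨c, bipH q, bipY q (BR q) (BC q), fun x y => f (φ2 x) (φ2 y), fun x y => f (φ2 x) (φ2 y), hc1, hc,
      hf.toGood.comp φ2, hf.toGood.comp φ2, bipB_good q (by omega), ?_⟩
    rintro (x | x)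
    · refine gen1 hp hq hf φ2 hc (bipB_good q (by omega)) x (hF _) ?_
      intro J hJ hh
      exact hp1 (hv _ J hJ hh.1 hh.2).2.2
    by_cases hx : x = (false, false, ⟨0, hq0⟩)
    · subst hx
      obtain ⟨r1, r2, r3⟩ := bipB_row0 q (by omega)
      have hR1 := rowF (a := a) (c := c) (D := Λ + 8 * q * q) (f1 := fun x y => f (φ2 x) (φ2 y))
        (f2 := fun x y => f (φ2 x) (φ2 y)) r1 (by omega)
      have hR2 := rowT (a := a) (c := c) (D := Λ + 8 * q * q) (f1 := fun x y => f (φ2 x) (φ2 y))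
        (f2 := fun x y => f (φ2 x) (φ2 y)) r2 (by omega)
      have hR3 := rowT (a := a) (c := c) (D := Λ + 8 * q * q) (f1 := fun x y => f (φ2 x) (φ2 y))
        (f2 := fun x y => f (φ2 x) (φ2 y)) r3 (by omega)
      exact V2both2 (Λ := Λ) (a := a) (c := c) (N := 8 * q * q) (D := Λ + 8 * q * q) (hS2 φ2 hc _)
        hq hp (hF _) I I' hI hI' hne i1 i2 i3 j1 j2 hc rfl (by omega) (by simpa using hR1) hR3 (by simpa using hR2)
    · refine gen2 hp hq φ2 hc (bipB_good q (by omega)) x (hF _) (hgen _ ?_)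
      rw [← e1]; exact fun hh => hx (φ2.injective hh)

theorem concl_of (hp : 0 < p) (hq : 2 * p ≤ q) (hf : GoodIn Λ a f)
    (hF : ∀ v, IvFam p m l (LS a f v) (F v)) : Concl p q m l Λ a := by
  have ha : 4 * q ≤ 2 * a := mid_ge hf (by omega)
  by_cases hb : ∃ u, ∃ I ∈ F u, ∃ I' ∈ F u, I.1 < 0 ∧ 0 < I.2 ∧ I'.1 < (a : ℤ) ∧ (a : ℤ) < I'.2
  swap
  · refine caseNot hp hq hf hF ?_
    intro u I hI I' hI' h1 h2 h3 h4
    exact hb ⟨u, I, hI, I', hI', h1, h2, h3, h4⟩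
  obtain ⟨u, I, hI, I', hI', h1, h2, h3, h4⟩ := hb
  have k1 := cross0_le (by omega) hf hF hI h1
  have k2 := crossa_ge (by omega) hf hF hI' h4
  have hne : I' ≠ I := by rintro rfl; omega
  have hd : I.2 ≤ I'.1 := by
    have hpw := (hF u).2.2.1
    obtain ⟨i, hi, ei⟩ := List.mem_iff_getElem.1 hI
    obtain ⟨j, hj, ej⟩ := List.mem_iff_getElem.1 hI'
    rcases lt_trichotomy i j with h | h | h
    · have := List.pairwise_iff_getElem.1 hpw i j hi hj h
      rw [ei, ej] at this; omega
    · subst h; rw [ei] at ej; exact absurd ej.symm hne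
    · have := List.pairwise_iff_getElem.1 hpw j i hj hi h
      rw [ei, ej] at this; omega
  have hsum : I.2 + (a - I'.1) ≤ 3 := by
    have := mid3 hf (x := u) (Finset.Ico 0 I.2 ∪ Finset.Ico I'.1 a) (by
      intro z hz
      rw [Finset.mem_union, Finset.mem_Ico, Finset.mem_Ico] at hz
      rcases hz with hz | hz
      · exact ⟨by omega, by omega, ((hF u).2.1 I hI).2 z (by omega) (by omega)⟩
      · exact ⟨by omega, by omega, ((hF u).2.1 I' hI').2 z (by omega) (by omega)⟩)
    rw [Finset.card_union_of_disjoint] at this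
    · simp at this; omega
    · rw [Finset.disjoint_left]
      intro z hz hz'
      rw [Finset.mem_Ico] at hz hz'
      omega
  by_cases hone : I'.1 = a - 1
  · exact caseBoth hp hq hf hF u I I' hI hI' hne h1 h2 (by omega) hone h4
  · refine caseBoth (F := fun v => (F v).map fun I => ((a : ℤ) - I.2, (a : ℤ) - I.1)) hp hq (rf_good hf)
      (fun v => rf_fam (hF v)) u ((a : ℤ) - I'.2, (a : ℤ) - I'.1) ((a : ℤ) - I.2, (a : ℤ) - I.1)
      (List.mem_map_of_mem hI') (List.mem_map_of_mem hI) ?_ ?_ ?_ ?_ ?_ ?_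
    · intro h
      rw [Prod.mk.injEq] at h
      omega
    all_goals simp only
    all_goals omega

end cases

theorem concl8 {p q m ℓ Λ a : ℕ} (hp : 0 < p) (h : Concl p q m ℓ Λ a) :
    ∃ t₁ : Sym2 (Fin (8 * q)) → ℕ, Swap.AstrayGood (8 * q) 3 t₁ ∧
      Swap.LabelingHasType (8 * q) p (m + 2) (ℓ + 2 * q) t₁ := by
  obtain ⟨c, h, y, f1, f2, hc1, hc, g1, g2, hb, hv⟩ := h
  have hg := asm_good hc g1 g2 hb
  have φ : Fin (8 * q) ≃ Al q ⊕ Al q := (Fintype.equivFinOfCardEq (by simp; ring)).symm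
  refine ⟨_, bridge2_good (hg.comp φ), bridge2_type (hg.comp φ) hp ?_⟩
  intro v
  rw [LS_comp φ v]
  push_cast
  exact hv (φ v)

theorem concl84 {p q m ℓ Λ a : ℕ} (hp : 0 < p) (hq : 2 * p ≤ q) (hm : 0 < m) (hl : ℓ ≤ 4 * q) (h : Concl p q m ℓ Λ a) :
    ∃ t₂ : Sym2 (Fin (8 * q + 4)) → ℕ, Swap.AstrayGood (8 * q + 4) 3 t₂ ∧
      Swap.LabelingHasType (8 * q + 4) p (m + 2) (ℓ + 2 * q) t₂ := by
  obtain ⟨c, h, y, f1, f2, hc1, hc, g1, g2, hb, hv⟩ := h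
  have hg := asm_good hc g1 g2 hb
  have ι : Al q ≃ Fin (4 * q) := Fintype.equivFinOfCardEq (by simp; ring)
  have hg' := ext_good ι hg (c := c) (by omega)
  have φ : Fin (8 * q + 4) ≃ (Al q ⊕ Al q) ⊕ Fin 4 := (Fintype.equivFinOfCardEq (by simp; ring)).symm
  refine ⟨_, bridge2_good (hg'.comp φ), bridge2_type (hg'.comp φ) hp ?_⟩
  intro v
  rw [LS_comp φ v]
  push_cast
  rcases φ v with x | j
  · exact ext_old ι (by omega) x (asm_cut hc1 hc x) (hv x)
  · exact ext_new ι j (by omega) (by omega) (by push_cast; omega)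

end Swap17

theorem stmt17 (p q m ℓ : ℕ) (hp : 0 < p) (hm : 0 < m) (hℓ : 0 < ℓ) (hq : 2 * p ≤ q)
    (t : Sym2 (Fin (4 * q)) → ℕ) (ht : Swap.AstrayGood (4 * q) 3 t)
    (htype : Swap.LabelingHasType (4 * q) p m ℓ t) :
    (∃ t₁ : Sym2 (Fin (8 * q)) → ℕ, Swap.AstrayGood (8 * q) 3 t₁ ∧
      Swap.LabelingHasType (8 * q) p (m + 2) (ℓ + 2 * q) t₁) ∧
    (∃ t₂ : Sym2 (Fin (8 * q + 4)) → ℕ, Swap.AstrayGood (8 * q + 4) 3 t₂ ∧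
      Swap.LabelingHasType (8 * q + 4) p (m + 2) (ℓ + 2 * q) t₂) := by
  obtain ⟨Λ, a, -, hg⟩ := Swap17.bridge1_good ht
  have hF := Swap17.bridge1_type (Λ := Λ) (a := a) htype
  choose F hF using hF
  have hl : ℓ ≤ 4 * q := Swap17.type_le htype ⟨0, by omega⟩
  have hC := Swap17.concl_of hp hq hg hF
  exact ⟨Swap17.concl8 hp hC, Swap17.concl84 hp hq hm hl hC⟩
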